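/- arXiv:2311.00649 — 4 statements merged into one kernel-verified Lean document; each statement's English description precedes it below -/
import Mathlib

section
/- Let Γ be a countable group with a locally finite normal subgroup F ⊴ Γ such that the quotient Γ/F is virtually ℤ. Let Γ act minimally and continuously on a Cantor set X such that the orbit space X/F is Hausdorff. Then the action is almost finite in measure if and only if it is essentially free. -/
open scoped Pointwise
open MeasureTheory

namespace Paper

section Basic

variable (G : Type*) [Group G] (X : Type*) [TopologicalSpace X] [MulAction G X]

/-- The action is minimal: every orbit is dense. -/
def Minimal : Prop := ∀ x : X, Dense (MulAction.orbit G x)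

/-- The action is topologically free: every nontrivial fixed-point set is nowhere dense. -/
def TopFree : Prop := ∀ g : G, g ≠ 1 → interior (closure {x : X | g • x = x}) = (∅ : Set X)

variable [MeasurableSpace X]

/-- `μ` is a `G`-invariant Borel probability measure. -/
def InvProb (μ : Measure X) : Prop :=
  IsProbabilityMeasure μ ∧ ∀ g : G, Measure.map (fun x : X => g • x) μ = μ

/-- The action is essentially free. -/
def EssFree : Prop :=
  ∀ g : G, g ≠ 1 → ∀ μ : Measure X, InvProb G X μ → μ {x : X | g • x = x} = 0

/-- The small boundary property. -/
def SBP : Prop :=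
  ∀ (x : X) (U : Set X), IsOpen U → x ∈ U →
    ∃ V : Set X, IsOpen V ∧ x ∈ V ∧ V ⊆ U ∧
      ∀ μ : Measure X, InvProb G X μ → μ (frontier V) = 0

end Basic

/-- `S` is a `(K, ε)`-Følner set: `|KS \ S| < ε |S|`. -/
def IsFolner {G : Type*} [Group G] (K S : Finset G) (ε : ℝ) : Prop :=
  letI := Classical.decEq G
  (((K * S) \ S).card : ℝ) < ε * S.card

/-- Amenability in the Følner sense. -/
def FolnerAmenable (G : Type*) [Group G] : Prop :=
  ∀ (K : Finset G) (ε : ℝ), 0 < ε → ∃ S : Finset G, IsFolner K S ε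

/-- A finite family of towers forming a castle: all levels are pairwise disjoint. -/
def IsCastle (G : Type*) [Group G] (X : Type*) [MulAction G X] {n : ℕ}
    (S : Fin n → Finset G) (B : Fin n → Set X) : Prop :=
  ∀ (i j : Fin n), ∀ s ∈ S i, ∀ t ∈ S j, (i, s) ≠ (j, t) → Disjoint (s • B i) (t • B j)

/-- The union of all levels of a castle. -/
def CastleUnion (G : Type*) [Group G] (X : Type*) [MulAction G X] {n : ℕ}
    (S : Fin n → Finset G) (B : Fin n → Set X) : Set X :=
  ⋃ i, ⋃ s ∈ S i, s • B i

/-- `C ≺ O` : dynamical subordination of a (closed) set `C` to `O`. -/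
def Subord (G : Type*) [Group G] (X : Type*) [TopologicalSpace X] [MulAction G X]
    (C O : Set X) : Prop :=
  ∃ (n : ℕ) (V : Fin n → Set X) (g : Fin n → G),
    (∀ k, IsOpen (V k)) ∧ (C ⊆ ⋃ k, V k) ∧ (∀ k, g k • V k ⊆ O) ∧
      Pairwise fun k l => Disjoint (g k • V k) (g l • V l)

/-- `U ≺ O` for open `U`: every closed subset of `U` is subordinate to `O`. -/
def SubordOpen (G : Type*) [Group G] (X : Type*) [TopologicalSpace X] [MulAction G X]
    (U O : Set X) : Prop :=
  ∀ C : Set X, IsClosed C → C ⊆ U → Subord G X C O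

/-- Dynamical comparison. -/
def DynComparison (G : Type*) [Group G] (X : Type*) [TopologicalSpace X] [MulAction G X]
    [MeasurableSpace X] : Prop :=
  ∀ U O : Set X, IsOpen U → IsOpen O → U.Nonempty → O.Nonempty →
    (∀ μ : Measure X, InvProb G X μ → μ U < μ O) → SubordOpen G X U O

/-- Almost finiteness (Kerr). -/
def AlmostFinite (G X : Type*) [Group G] [MetricSpace X] [MulAction G X] : Prop :=
  ∀ (K : Finset G) (m : ℕ), 0 < m → ∀ ε : ℝ, 0 < ε →
    ∃ (n : ℕ) (S : Fin n → Finset G) (B : Fin n → Set X),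
      IsCastle G X S B ∧ (∀ i, IsOpen (B i)) ∧ (∀ i, IsFolner K (S i) ε) ∧
      (∀ i, ∀ s ∈ S i, Metric.diam (s • B i) < ε) ∧
      ∃ S' : Fin n → Finset G,
        (∀ i, S' i ⊆ S i ∧ ((S' i).card : ℝ) < (S i).card / m) ∧
        Subord G X (Set.univ \ CastleUnion G X S B) (CastleUnion G X S' B)

/-- Almost finiteness in measure (Kerr–Szabó). -/
def AlmostFiniteInMeasure (G X : Type*) [Group G] [MetricSpace X] [MulAction G X]
    [MeasurableSpace X] : Prop :=
  ∀ (K : Finset G) (ε : ℝ), 0 < ε →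
    ∃ (n : ℕ) (S : Fin n → Finset G) (B : Fin n → Set X),
      IsCastle G X S B ∧ (∀ i, IsOpen (B i)) ∧ (∀ i, IsFolner K (S i) ε) ∧
      (∀ i, ∀ s ∈ S i, Metric.diam (s • B i) < ε) ∧
      (⨆ μ : {μ : Measure X // InvProb G X μ},
        (μ : Measure X) (Set.univ \ CastleUnion G X S B)) < ENNReal.ofReal ε

/-- Every finitely generated subgroup is finite. -/
def LocallyFiniteGroup (G : Type*) [Group G] : Prop :=
  ∀ H : Subgroup G, H.FG → (H : Set G).Finite

/-- `G` is virtually `ℤ`. -/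
def VirtuallyZ (G : Type*) [Group G] : Prop :=
  ∃ H : Subgroup G, H.FiniteIndex ∧ Nonempty (H ≃* Multiplicative ℤ)

end Paper

open Paper

/-- An action of `G` on `ℤ` by affine isometries `u ↦ σ g * u + b g` whose point stabilizers are
finite, presented as a cocycle. -/
structure ProperAffineCocycle (G : Type*) [Group G] where
  /-- the linear part -/
  σ : G →* ℤ
  /-- the translation part -/
  b : G → ℤ
  map_mul : ∀ g h, b (g * h) = b g + σ g * b h
  finite_le : ∀ L : ℤ, {g | |b g| ≤ L}.Finite

namespace ProperAffineCocycle

variable {G : Type*} [Group G]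

section Basic

variable (c : ProperAffineCocycle G)

theorem σ_eq (g : G) : c.σ g = 1 ∨ c.σ g = -1 := by
  have h : IsUnit (c.σ g) := (Group.isUnit g).map c.σ
  exact Int.isUnit_iff.mp h

theorem b_one : c.b 1 = 0 := by
  have := c.map_mul 1 1
  simp at this
  exact this

theorem b_inv (g : G) : c.b g + c.σ g * c.b g⁻¹ = 0 := by
  rw [← c.map_mul, mul_inv_cancel, b_one]

theorem abs_b_inv (g : G) : |c.b g⁻¹| = |c.b g| := by
  have h := c.b_inv g
  rcases c.σ_eq g with h1 | h1 <;> rw [h1] at h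
  · rw [show c.b g⁻¹ = -c.b g by linarith, abs_neg]
  · rw [show c.b g⁻¹ = c.b g by linarith]

theorem abs_b_mul_le (g h : G) : |c.b (g * h)| ≤ |c.b g| + |c.b h| := by
  rw [c.map_mul]
  rcases c.σ_eq g with h1 | h1 <;> rw [h1] <;> grind

theorem abs_b_inv_mul (g h : G) : |c.b (g⁻¹ * h)| = |c.b h - c.b g| := by
  have h1 := c.map_mul g (g⁻¹ * h)
  rw [mul_inv_cancel_left] at h1
  rcases c.σ_eq g with h2 | h2 <;> rw [h2] at h1 <;> grind

/-- Pull back a cocycle along a homomorphism with finite kernel. -/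
def comap {H : Type*} [Group H] (f : H →* G) (hf : ∀ g, (f ⁻¹' {g}).Finite) :
    ProperAffineCocycle H where
  σ := c.σ.comp f
  b h := c.b (f h)
  map_mul g h := by simp [c.map_mul]
  finite_le L := (c.finite_le L).preimage' fun g _ => hf g

/-- The finite set of elements moving the origin by at most `L`. -/
noncomputable def ball (L : ℤ) : Finset G := (c.finite_le L).toFinset

@[simp] theorem mem_ball {L : ℤ} {g : G} : g ∈ c.ball L ↔ |c.b g| ≤ L := by simp [ball]

theorem inv_mem_ball {L : ℤ} {g : G} : g⁻¹ ∈ c.ball L ↔ g ∈ c.ball L := by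
  simp [c.abs_b_inv]

theorem exists_lt_card_ball [Infinite G] (C : ℝ) (m : ℤ) :
    ∃ j, m ≤ j ∧ C < (c.ball j).card := by
  obtain ⟨n, hn⟩ := exists_nat_gt C
  obtain ⟨t, ht⟩ := Infinite.exists_subset_card_eq G n
  refine ⟨max m (t.sup fun g => (c.b g).natAbs : ℕ), le_max_left _ _, hn.trans_le ?_⟩
  rw [← ht]
  refine Nat.cast_le.mpr (Finset.card_le_card fun g hg => ?_)
  rw [mem_ball]
  refine le_trans ?_ (le_max_right _ _)
  rw [Int.abs_eq_natAbs]
  exact_mod_cast Finset.le_sup (f := fun g => (c.b g).natAbs) hg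

end Basic

section Existence

variable (N : Subgroup G) [N.Normal] [N.FiniteIndex] (t : G)

/-- If `⟨t⟩ ≅ ℤ` is a normal subgroup of finite index, then a cocycle is obtained by transfer. -/
theorem nonempty_of_zpowers_eq (ht : Subgroup.zpowers t = N)
    (hinj : Function.Injective fun n : ℤ => t ^ n) : Nonempty (ProperAffineCocycle G) := by
  classical
  have hN : ∀ x ∈ N, ∃ n : ℤ, t ^ n = x := fun x hx => by
    rwa [← ht] at hx
  have hconj : ∀ g : G, ∃ s : ℤ, t ^ s = g * t * g⁻¹ := fun g => by
    have : g * t * g⁻¹ ∈ N := Subgroup.Normal.conj_mem inferInstance t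
      (ht ▸ Subgroup.mem_zpowers t) g
    exact hN _ this
  choose s hs using hconj
  have hs' : ∀ g (n : ℤ), g * t ^ n = t ^ (s g * n) * g := fun g n => by
    rw [zpow_mul, hs, conj_zpow]
    group
  have hc : ∀ (g : G) (q : G ⧸ N), ∃ n : ℤ,
      g * q.out = t ^ n * ((g : G ⧸ N) * q).out := fun g q => by
    have : g * q.out * (((g : G ⧸ N) * q).out)⁻¹ ∈ N := by
      rw [← QuotientGroup.eq_one_iff]
      simp
    obtain ⟨n, hn⟩ := hN _ this
    exact ⟨n, by rw [hn]; group⟩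
  choose k hk using hc
  let σ : G →* ℤ :=
    { toFun := s
      map_one' := hinj (by simp [hs])
      map_mul' := fun g h => hinj (by
        simp only [hs]
        have := hs' g (s h)
        rw [hs] at this
        calc g * h * t * (g * h)⁻¹ = g * (h * t * h⁻¹) * g⁻¹ := by group
          _ = _ := by rw [this]; group) }
  have hkmul : ∀ g h q, k (g * h) q = k g (h * q) + s g * k h q := fun g h q => hinj (by
    simp only
    have h1 := hk (g * h) q
    rw [mul_assoc, hk h, ← mul_assoc, hs', mul_assoc, hk g, ← mul_assoc, ← zpow_add] at h1
    rw [← mul_assoc (g : G ⧸ N)] at h1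
    rw [add_comm]
    exact (mul_right_cancel h1).symm)
  have hkt : ∀ (n : ℤ) q, k (t ^ n) q = n := fun n q => hinj (by
    have h1 := hk (t ^ n) q
    have h2 : ((t ^ n : G) : G ⧸ N) = 1 := by
      rw [QuotientGroup.eq_one_iff, ← ht]
      exact ⟨n, rfl⟩
    rw [h2, one_mul] at h1
    exact (mul_right_cancel h1).symm)
  have hst : ∀ n : ℤ, s (t ^ n) = 1 := fun n => hinj (by simp only [hs]; group)
  let _ : Fintype (G ⧸ N) := Fintype.ofFinite _
  have hmul : ∀ g h, ∑ q, k (g * h) q = ∑ q, k g q + s g * ∑ q, k h q := fun g h => by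
    simp only [hkmul, Finset.sum_add_distrib, Finset.mul_sum]
    congr 1
    exact Fintype.sum_equiv (Equiv.mulLeft (h : G ⧸ N)) _ _ fun q => rfl
  refine ⟨⟨σ, fun g => ∑ q, k g q, hmul, fun L => ?_⟩⟩
  refine Set.Finite.of_injOn (f := fun g => (∑ q, k g q, (g : G ⧸ N)))
    (t := Set.Icc (-L) L ×ˢ Set.univ) (fun g hg => ⟨abs_le.mp hg, trivial⟩) ?_
    ((Set.finite_Icc _ _).prod Set.finite_univ)
  intro g _ h _ hgh
  simp only [Prod.mk.injEq] at hgh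
  obtain ⟨hb, hq⟩ := hgh
  have hmem : h * g⁻¹ ∈ N := by
    rw [← QuotientGroup.eq_one_iff]
    simp [hq]
  obtain ⟨n, hn⟩ := hN _ hmem
  have hh : h = t ^ n * g := by rw [hn]; group
  rw [hh, hmul] at hb
  simp only [hkt, hst, one_mul, Finset.sum_const, Finset.card_univ] at hb
  have hn0 : n = 0 := by
    have : Fintype.card (G ⧸ N) • n = 0 := by linarith
    simpa using this
  simp [hh, hn0]

end Existence

end ProperAffineCocycle

theorem Paper.VirtuallyZ.infinite {G : Type*} [Group G] (hG : VirtuallyZ G) : Infinite G := by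
  obtain ⟨H, -, ⟨e⟩⟩ := hG
  have : Infinite H := e.toEquiv.infinite_iff.mpr inferInstance
  exact Infinite.of_injective _ H.subtype_injective

theorem Paper.VirtuallyZ.nonempty_properAffineCocycle {G : Type*} [Group G] (hG : VirtuallyZ G) :
    Nonempty (ProperAffineCocycle G) := by
  have hinf := hG.infinite
  obtain ⟨H, hH, ⟨e⟩⟩ := hG
  have : IsCyclic H := isCyclic_of_injective e.toMonoidHom e.injective
  have : IsCyclic H.normalCore :=
    isCyclic_of_injective (Subgroup.inclusion H.normalCore_le) (Subgroup.inclusion_injective _)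
  obtain ⟨t, ht⟩ := H.normalCore.isCyclic_iff_exists_zpowers_eq_top.mp this
  refine ProperAffineCocycle.nonempty_of_zpowers_eq H.normalCore t ht ?_
  rw [injective_zpow_iff_not_isOfFinOrder]
  intro hfin
  have h1 : Finite H.normalCore := by
    rw [← ht]
    exact hfin.finite_zpowers
  have : Finite G := H.normalCore.finite_iff_finite_and_finiteIndex.mpr ⟨h1, inferInstance⟩
  exact not_finite G

theorem Paper.isFolner_iff {G : Type*} [Group G] [DecidableEq G] {K S : Finset G} {ε : ℝ} :
    IsFolner K S ε ↔ (((K * S) \ S).card : ℝ) < ε * S.card := by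
  unfold IsFolner
  rw [Subsingleton.elim (Classical.decEq G) ‹DecidableEq G›]

namespace ProperAffineCocycle

variable {G : Type*} [Group G]

section Cell

variable [Countable G] (c : ProperAffineCocycle G)

/-- An injective key comparing elements by how far they move the origin, with ties broken by an
enumeration of `G`. -/
noncomputable def key (g : G) : ℤ ×ₗ ℕ :=
  toLex (|c.b g|, (exists_injective_nat G).choose g)

theorem key_injective : Function.Injective c.key := fun g h hgh => by
  simp only [key, EmbeddingLike.apply_eq_iff_eq, Prod.mk.injEq] at hgh
  exact (exists_injective_nat G).choose_spec hgh.2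

theorem abs_b_le_of_key_le {g h : G} (hgh : c.key g ≤ c.key h) : |c.b g| ≤ |c.b h| := by
  simp only [key, Prod.Lex.toLex_le_toLex] at hgh
  rcases hgh with h1 | h1
  · exact h1.le
  · exact h1.1.le

open Classical in
/-- The Voronoi cell of the origin, where `D` is the set of return times to the set of sites. -/
noncomputable def cell (L : ℤ) (D : Set G) : Finset G :=
  (c.ball L).filter fun g => ∀ d ∈ c.ball L, d * g ∈ D → c.key g⁻¹ ≤ c.key d

variable {c} {L : ℤ} {D : Set G}

theorem mem_cell {g : G} : g ∈ c.cell L D ↔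
    |c.b g| ≤ L ∧ ∀ d, |c.b d| ≤ L → d * g ∈ D → c.key g⁻¹ ≤ c.key d := by
  simp [cell]

theorem cell_congr {D' : Set G} (h : ∀ d ∈ c.ball L, ∀ g ∈ c.ball L, d * g ∈ D ↔ d * g ∈ D') :
    c.cell L D = c.cell L D' := by
  ext g
  simp only [mem_cell, mem_ball] at h ⊢
  refine and_congr_right fun hg => forall₂_congr fun d hd => ?_
  rw [h d hd g hg]

theorem ball_subset_cell {j : ℤ} (hj : 2 * j ≤ L) (hD : ∀ d ∈ D, d ≠ 1 → L < |c.b d|) :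
    c.ball j ⊆ c.cell L D := by
  intro g hg
  rw [mem_ball] at hg
  have h0 := abs_nonneg (c.b g)
  refine mem_cell.mpr ⟨by linarith, fun d hd hdg => ?_⟩
  rcases eq_or_ne (d * g) 1 with h1 | h1
  · rw [eq_inv_of_mul_eq_one_left h1]
  · by_contra! hlt
    have h2 := c.abs_b_le_of_key_le hlt.le
    have h3 := hD _ hdg h1
    have h4 := c.abs_b_mul_le d g
    rw [abs_b_inv] at h2
    linarith

/-- The height of an element at the boundary of a cell is almost maximal in the cell. -/
theorem abs_b_le_of_mem_boundary {m : ℤ} (hL : 2 * m ≤ L)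
    (hD : ∀ d ∈ D, d ≠ 1 → L < |c.b d|) {k g h : G} (hk : |c.b k| ≤ m)
    (hg : g ∈ c.cell L D) (hkg : k * g ∉ c.cell L D) (hh : h ∈ c.cell L D)
    (hσ : c.σ g = c.σ h) (hs : 0 ≤ c.b g ↔ 0 ≤ c.b h) :
    |c.b h| ≤ |c.b g| + m := by
  rw [mem_cell] at hg hh
  have h1 := c.abs_b_mul_le k g
  by_cases hkL : L < |c.b (k * g)|
  · linarith
  rw [mem_cell] at hkg
  push Not at hkg hkL
  obtain ⟨d, hd, hdD, hlt⟩ := hkg hkL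
  have h2 := c.abs_b_le_of_key_le hlt.le
  rw [abs_b_inv] at h2
  have hne : d * (k * g) ≠ 1 := fun h => hlt.ne (by rw [eq_inv_of_mul_eq_one_left h])
  have hw := hD _ hdD hne
  generalize he : d * (k * g) = e at *
  have h3 : |c.b (e * g⁻¹)| ≤ |c.b g| + 2 * m := by
    have := c.abs_b_mul_le d k
    rw [← he, show d * (k * g) * g⁻¹ = d * k by group]
    linarith
  have h4 : |c.b h| ≤ |c.b (e * h⁻¹)| := by
    by_cases h5 : |c.b (e * h⁻¹)| ≤ L
    · have := c.abs_b_le_of_key_le (hh.2 _ h5 (by simpa using hdD))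
      rwa [abs_b_inv] at this
    · linarith [hh.1]
  have h5 : ∀ x, |c.b (e * x⁻¹)| = |c.b x + c.σ x * c.b e⁻¹| := fun x => by
    rw [← c.map_mul, ← c.abs_b_inv (x * e⁻¹)]
    simp
  rw [h5, hσ] at h3
  rw [h5] at h4
  rw [← c.abs_b_inv] at hw
  have hgL := hg.1
  have hhL := hh.1
  generalize c.b g = v at *
  generalize c.b h = v' at *
  generalize hu : c.σ h * c.b e⁻¹ = u at *
  have hu' : |c.b e⁻¹| = |u| := by
    rcases c.σ_eq h with h6 | h6 <;> rw [h6] at hu <;> subst hu <;> simp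
  rw [hu'] at hw
  clear hu hu' h5
  have hm := abs_nonneg (c.b k)
  grind

theorem card_boundary_le {m : ℤ} (hL : 2 * m ≤ L)
    (hD : ∀ d ∈ D, d ≠ 1 → L < |c.b d|) {k : G} (hk : |c.b k| ≤ m) (P : Finset G)
    (hP : ∀ g ∈ P, g ∈ c.cell L D ∧ k * g ∉ c.cell L D) :
    P.card ≤ (c.ball m).card * 4 := by
  classical
  let f : G → Bool × Bool := fun g => (decide (c.σ g = 1), decide (0 ≤ c.b g))
  refine (Finset.card_le_mul_card_image (f := f) P (c.ball m).card ?_).trans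
    (Nat.mul_le_mul_left _ ((Finset.card_le_univ _).trans_eq (by simp)))
  intro a ha
  obtain ⟨g, hg, rfl⟩ := Finset.mem_image.mp ha
  refine Finset.card_le_card_of_injOn (fun h => g⁻¹ * h) ?_ (mul_right_injective g⁻¹).injOn
  intro h hh
  simp only [Finset.coe_filter, Set.mem_ofPred_eq, f, Prod.mk.injEq, decide_eq_decide] at hh
  obtain ⟨hh, hσ, hs⟩ := hh
  have hσ' : c.σ g = c.σ h := by
    rcases c.σ_eq g with h1 | h1 <;> rcases c.σ_eq h with h2 | h2 <;> simp_all
  have h1 := abs_b_le_of_mem_boundary hL hD hk (hP g hg).1 (hP g hg).2 (hP h hh).1 hσ' hs.symm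
  have h2 := abs_b_le_of_mem_boundary hL hD hk (hP h hh).1 (hP h hh).2 (hP g hg).1 hσ'.symm hs
  simp only [Finset.mem_coe, mem_ball]
  rw [c.abs_b_inv_mul]
  grind

theorem exists_isFolner_cell [Infinite G] (c : ProperAffineCocycle G) (K : Finset G) {ε : ℝ}
    (hε : 0 < ε) : ∃ L, 0 ≤ L ∧ ∀ D : Set G, (∀ d ∈ D, d ≠ 1 → L < |c.b d|) →
      IsFolner K (c.cell L D) ε := by
  classical
  let m : ℤ := (K.sup fun g => (c.b g).natAbs : ℕ)
  have hm : ∀ k ∈ K, |c.b k| ≤ m := fun k hk => by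
    rw [Int.abs_eq_natAbs, Nat.cast_le]
    exact Finset.le_sup (f := fun g => (c.b g).natAbs) hk
  have hm0 : 0 ≤ m := Int.natCast_nonneg _
  obtain ⟨j, hmj, hj⟩ :=
    c.exists_lt_card_ball (K.card * ((c.ball m).card * 4) / ε : ℝ) m
  refine ⟨2 * j, by linarith, fun D hD => ?_⟩
  have h1 : ((K * c.cell (2 * j) D) \ c.cell (2 * j) D).card ≤
      K.card * ((c.ball m).card * 4) := by
    let P (k : G) : Finset G := {g ∈ c.cell (2 * j) D | k * g ∉ c.cell (2 * j) D}
    have hsub : (K * c.cell (2 * j) D) \ c.cell (2 * j) D ⊆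
        K.biUnion fun k => (P k).image (k * ·) := by
      intro x hx
      obtain ⟨hx, hxS⟩ := Finset.mem_sdiff.mp hx
      obtain ⟨k, hk, g, hg, rfl⟩ := Finset.mem_mul.mp hx
      simp only [Finset.mem_biUnion, Finset.mem_image]
      exact ⟨k, hk, g, Finset.mem_filter.mpr ⟨hg, hxS⟩, rfl⟩
    refine (Finset.card_le_card hsub).trans (Finset.card_biUnion_le_card_mul _ _ _ fun k hk => ?_)
    refine Finset.card_image_le.trans (card_boundary_le (by linarith) hD (hm k hk) _ fun g hg => ?_)
    exact Finset.mem_filter.mp hg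
  have h2 := Finset.card_le_card (ball_subset_cell (c := c) (D := D) le_rfl hD)
  rw [div_lt_iff₀ hε] at hj
  rw [isFolner_iff]
  have h1' : (((K * c.cell (2 * j) D) \ c.cell (2 * j) D).card : ℝ) ≤
      K.card * ((c.ball m).card * 4) := by exact_mod_cast h1
  have h2' : ((c.ball j).card : ℝ) ≤ (c.cell (2 * j) D).card := by exact_mod_cast h2
  nlinarith

end Cell

end ProperAffineCocycle

section Clopen

variable {G X : Type*} [Group G] [TopologicalSpace X] [MulAction G X] [ContinuousConstSMul G X]

theorem IsClopen.smul_set {A : Set X} (hA : IsClopen A) (g : G) : IsClopen (g • A) :=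
  ⟨hA.1.smul g, hA.2.smul g⟩

/-- A clopen set without points fixed by the elements of `E` other than `1` is covered by the
`E`-translates of an `E`-separated clopen set. -/
theorem exists_isClopen_separated [CompactSpace X] [T2Space X] [TotallyDisconnectedSpace X]
    (E : Finset G) (h1 : 1 ∈ E) (hinv : ∀ g ∈ E, g⁻¹ ∈ E) {V : Set X} (hV : IsClosed V)
    (hfix : ∀ g ∈ E, g ≠ 1 → ∀ x ∈ V, g • x ≠ x) :
    ∃ A : Set X, IsClopen A ∧ (∀ g ∈ E, g ≠ 1 → Disjoint (g • A) A) ∧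
      V ⊆ ⋃ g ∈ E, g • A := by
  have hloc : ∀ x ∈ V, ∃ U : Set X, IsClopen U ∧ x ∈ U ∧
      ∀ g ∈ E, g ≠ 1 → Disjoint (g • U) U := by
    intro x hx
    have hev : ∀ᶠ U in (nhds x).smallSets, ∀ g ∈ E, g ≠ 1 → Disjoint (g • U) U := by
      rw [Filter.eventually_all_finset]
      intro g hg
      rcases eq_or_ne g 1 with hg1 | hg1
      · exact .of_forall fun _ h => (h hg1).elim
      obtain ⟨P, hP, Q, hQ, hPQ⟩ := Filter.disjoint_iff.mp
        (disjoint_nhds_nhds.mpr (hfix g hg hg1 x hx))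
      have hP' : (g • ·) ⁻¹' P ∈ nhds x := (continuous_const_smul g).continuousAt hP
      refine Filter.eventually_smallSets.mpr ⟨_, Filter.inter_mem hP' hQ, fun U hU _ => ?_⟩
      refine hPQ.mono ?_ fun y hy => (hU hy).2
      rintro _ ⟨y, hy, rfl⟩
      exact (hU hy).1
    obtain ⟨U, hU, hUE⟩ := Filter.eventually_smallSets.mp hev
    obtain ⟨U', hU', hxU', hsub⟩ := compact_exists_isClopen_in_isOpen isOpen_interior
      (mem_interior_iff_mem_nhds.mpr hU)
    exact ⟨U', hU', hxU', hUE U' (hsub.trans interior_subset)⟩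
  choose! U hU hxU hUE using hloc
  obtain ⟨T, hTV, hT⟩ := hV.isCompact.elim_nhds_subcover U
    fun x hx => (hU x hx).isOpen.mem_nhds (hxU x hx)
  suffices h : ∀ T : Finset X, (∀ x ∈ T, x ∈ V) → ∃ A : Set X, IsClopen A ∧
      (∀ g ∈ E, g ≠ 1 → Disjoint (g • A) A) ∧ ⋃ x ∈ T, U x ⊆ ⋃ g ∈ E, g • A by
    obtain ⟨A, hA, hAE, hsub⟩ := h T hTV
    exact ⟨A, hA, hAE, hT.trans hsub⟩
  classical
  intro T
  induction T using Finset.induction_on with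
  | empty => exact fun _ => ⟨∅, isClopen_empty, by simp, by simp⟩
  | insert x T hxT ih =>
    intro hTV
    obtain ⟨A, hA, hAE, hsub⟩ := ih fun y hy => hTV y (Finset.mem_insert_of_mem hy)
    have hxV := hTV x (Finset.mem_insert_self x T)
    have hEA : IsClopen (⋃ g ∈ E, g • A) :=
      E.finite_toSet.isClopen_biUnion fun g _ => hA.smul_set g
    refine ⟨A ∪ (U x \ ⋃ g ∈ E, g • A), hA.union ((hU x hxV).diff hEA), fun g hg hg1 => ?_, ?_⟩
    · have hmove : ∀ y, ∀ g ∈ E, g • y ∈ A → y ∈ ⋃ g ∈ E, g • A := fun y g hg hy =>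
        Set.mem_iUnion₂.mpr ⟨g⁻¹, hinv g hg, Set.mem_smul_set.mpr ⟨_, hy, inv_smul_smul g y⟩⟩
      rw [Set.disjoint_left]
      rintro _ ⟨y, hy, rfl⟩ hgy
      simp only at hgy
      rcases hy with hy | hy <;> rcases hgy with hgy | hgy
      · exact Set.disjoint_left.mp (hAE g hg hg1) (Set.smul_mem_smul_set hy) hgy
      · exact hgy.2 (Set.mem_iUnion₂.mpr ⟨g, hg, Set.smul_mem_smul_set hy⟩)
      · exact hy.2 (hmove y g hg hgy)
      · exact Set.disjoint_left.mp (hUE x hxV g hg hg1) (Set.smul_mem_smul_set hy.1) hgy.1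
    · have hmono : ⋃ g ∈ E, g • A ⊆ ⋃ g ∈ E, g • (A ∪ (U x \ ⋃ g ∈ E, g • A)) :=
        Set.iUnion₂_mono fun g _ => Set.smul_set_mono Set.subset_union_left
      rw [Finset.set_biUnion_insert]
      refine Set.union_subset (fun y hy => ?_) (hsub.trans hmono)
      by_cases hyA : y ∈ ⋃ g ∈ E, g • A
      · exact hmono hyA
      · exact Set.mem_iUnion₂.mpr ⟨1, h1, by rw [one_smul]; exact Or.inr ⟨hy, hyA⟩⟩

/-- A property of small sets is satisfied by the fibres of some locally constant map. -/
theorem exists_isLocallyConstant_fibre [CompactSpace X] [T2Space X] [TotallyDisconnectedSpace X]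
    (p : Set X → Prop) (hmono : ∀ U V, U ⊆ V → p V → p U) (hp : ∀ x, ∃ U ∈ nhds x, p U) :
    ∃ f : X → Finset X, IsLocallyConstant f ∧ ∀ x, p (f ⁻¹' {f x}) := by
  classical
  have hp' : ∀ x, ∃ U : Set X, IsClopen U ∧ x ∈ U ∧ p U := fun x => by
    obtain ⟨U, hU, hpU⟩ := hp x
    obtain ⟨U', hU', hxU', hsub⟩ := compact_exists_isClopen_in_isOpen isOpen_interior
      (mem_interior_iff_mem_nhds.mpr hU)
    exact ⟨U', hU', hxU', hmono _ _ (hsub.trans interior_subset) hpU⟩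
  choose U hU hxU hpU using hp'
  obtain ⟨T, hT⟩ := CompactSpace.elim_nhds_subcover U fun x => (hU x).isOpen.mem_nhds (hxU x)
  refine ⟨fun x => {y ∈ T | x ∈ U y}, ?_, fun x => ?_⟩
  · rw [IsLocallyConstant.iff_eventually_eq]
    intro x
    have : ∀ᶠ z in nhds x, ∀ y ∈ T, z ∈ U y ↔ x ∈ U y := by
      rw [Filter.eventually_all_finset]
      intro y _
      by_cases hxy : x ∈ U y
      · filter_upwards [(hU y).isOpen.mem_nhds hxy] with z hz
        simp [hz, hxy]
      · filter_upwards [(hU y).compl.isOpen.mem_nhds hxy] with z hz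
        simp only [hxy, iff_false]
        exact hz
    filter_upwards [this] with z hz
    exact Finset.filter_congr hz
  · have hx : x ∈ ⋃ y ∈ T, U y := hT ▸ Set.mem_univ x
    obtain ⟨y, hyT, hxy⟩ := Set.mem_iUnion₂.mp hx
    refine hmono _ _ (fun z hz => ?_) (hpU y)
    have : y ∈ ({y ∈ T | z ∈ U y} : Finset X) := by
      rw [show ({y ∈ T | z ∈ U y} : Finset X) = {y ∈ T | x ∈ U y} from hz]
      simp [hyT, hxy]
    exact (Finset.mem_filter.mp this).2

/-- A free orbit of a countable group which is closed in a compact space is finite. -/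
theorem finite_of_isClosed_orbit [Countable G] [CompactSpace X] [T2Space X] (x : X)
    (hx : ∀ g : G, g • x = x → g = 1) (hclosed : IsClosed (MulAction.orbit G x)) : Finite G := by
  let Y := MulAction.orbit G x
  have : CompactSpace Y := isCompact_iff_compactSpace.mp hclosed.isCompact
  have : Nonempty Y := ⟨⟨x, MulAction.mem_orbit_self x⟩⟩
  let p : G → Y := fun g => ⟨g • x, MulAction.mem_orbit x g⟩
  have hp : Function.Surjective p := fun ⟨y, g, hg⟩ => ⟨g, Subtype.ext hg⟩
  have hinj : Function.Injective p := fun g h hgh => by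
    have h1 : g • x = h • x := congrArg Subtype.val hgh
    have h2 := hx (h⁻¹ * g) (by rw [mul_smul, h1, inv_smul_smul])
    exact (inv_mul_eq_one.mp h2).symm
  obtain ⟨g, hg⟩ := nonempty_interior_of_iUnion_of_closed (f := fun g : G => ({p g} : Set Y))
    (fun g => isClosed_singleton)
    (Set.eq_univ_of_forall fun y => by
      obtain ⟨g, rfl⟩ := hp y
      exact Set.mem_iUnion.mpr ⟨g, rfl⟩)
  have hopen : IsOpen ({p g} : Set Y) := by
    rw [← (hg.subset_singleton_iff).mp interior_subset]
    exact isOpen_interior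
  have : DiscreteTopology Y := by
    rw [discreteTopology_iff_isOpen_singleton]
    intro y
    obtain ⟨h, rfl⟩ := hp y
    have hcont : Continuous fun y : Y => (g * h⁻¹) • y :=
      ((continuous_const_smul (g * h⁻¹)).comp continuous_subtype_val).subtype_mk _
    have hsmul : (g * h⁻¹) • p h = p g := Subtype.ext <| by
      change (g * h⁻¹) • h • x = g • x
      rw [← mul_smul, inv_mul_cancel_right]
    convert hopen.preimage hcont
    ext z
    rw [Set.mem_preimage, Set.mem_singleton_iff, Set.mem_singleton_iff, ← hsmul, smul_left_cancel_iff]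
  have : Finite Y := finite_of_compact_of_discrete
  exact Finite.of_injective p hinj

end Clopen

section Measure

variable {G X : Type*} [Group G] [MulAction G X] [TopologicalSpace X] [ContinuousConstSMul G X]
  [MeasurableSpace X] [BorelSpace X]

theorem Paper.InvProb.measure_smul {μ : Measure X} (hμ : InvProb G X μ) (g : G) {B : Set X}
    (hB : MeasurableSet B) : μ (g • B) = μ B := by
  conv_rhs => rw [← hμ.2 g⁻¹]
  rw [Measure.map_apply (continuous_const_smul g⁻¹).measurable hB, ← Set.preimage_smul_inv]

theorem isCompact_setOf_invProb [CompactSpace X] [TopologicalSpace.MetrizableSpace X] :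
    IsCompact {μ : ProbabilityMeasure X | InvProb G X μ} := by
  refine IsClosed.isCompact ?_
  have : {μ : ProbabilityMeasure X | InvProb G X μ} = ⋂ g : G, {μ | μ.map
      (continuous_const_smul g).measurable.aemeasurable = μ} := by
    ext μ
    simp only [Set.mem_ofPred_eq, Set.mem_iInter, InvProb]
    refine ⟨fun h g => Subtype.ext (h.2 g), fun h => ⟨inferInstance, fun g => ?_⟩⟩
    exact congrArg Subtype.val (h g)
  rw [this]
  exact isClosed_iInter fun g =>
    isClosed_eq (ProbabilityMeasure.continuous_map (continuous_const_smul g)) continuous_id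

/-- A closed set which is null for all invariant measures has a clopen neighbourhood of uniformly
small measure. -/
theorem exists_isClopen_forall_measure_lt [CompactSpace X] [TopologicalSpace.MetrizableSpace X]
    [TotallyDisconnectedSpace X] {C : Set X} (hC : IsClosed C)
    (hnull : ∀ μ : Measure X, InvProb G X μ → μ C = 0) {ε : ENNReal} (hε : 0 < ε) :
    ∃ W, IsClopen W ∧ C ⊆ W ∧ ∀ μ : Measure X, InvProb G X μ → μ W < ε := by
  have hloc : ∀ μ : ProbabilityMeasure X, InvProb G X μ → ∃ W, IsClopen W ∧ C ⊆ W ∧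
      ∀ᶠ ν : ProbabilityMeasure X in nhds μ, (ν : Measure X) W < ε := by
    intro μ hμ
    obtain ⟨U, hCU, hU, hμU⟩ := C.exists_isOpen_lt_of_lt (μ := (μ : Measure X)) ε
      (by rw [hnull μ hμ]; exact hε)
    obtain ⟨W, hW, hCW, hWU⟩ := exists_clopen_of_closed_subset_open hC hU hCU
    refine ⟨W, hW, hCW, ?_⟩
    have := ProbabilityMeasure.tendsto_measure_of_isClopen_of_tendsto
      (Filter.tendsto_id (x := nhds μ)) hW
    have h2 := (ENNReal.continuous_coe.tendsto _).comp this
    simp only [Function.comp_def, id, ProbabilityMeasure.ennreal_coeFn_eq_coeFn_toMeasure] at h2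
    exact h2.eventually_lt_const ((measure_mono hWU).trans_lt hμU)
  choose! W hW hCW hWε using hloc
  obtain ⟨T, hT, hcov⟩ := (isCompact_setOf_invProb (G := G) (X := X)).elim_nhds_subcover
    (fun μ => {ν | (ν : Measure X) (W μ) < ε}) hWε
  refine ⟨⋂ μ ∈ T, W μ, T.finite_toSet.isClopen_biInter fun μ hμ => hW μ (hT μ hμ),
    Set.subset_iInter₂ fun μ hμ => hCW μ (hT μ hμ), fun ν hν => ?_⟩
  have := hν.1
  obtain ⟨μ, hμT, hμ⟩ := Set.mem_iUnion₂.mp (hcov (a := ⟨ν, hν.1⟩) hν)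
  exact (measure_mono (Set.biInter_subset_of_mem hμT)).trans_lt hμ

end Measure

section AlmostFinite

variable {G X : Type*} [Group G] [MetricSpace X] [MulAction G X] [ContinuousConstSMul G X]
  [MeasurableSpace X] [BorelSpace X]

theorem Paper.AlmostFiniteInMeasure.essFree (h : AlmostFiniteInMeasure G X) : EssFree G X := by
  classical
  intro g hg μ hμ
  have hprob := hμ.1
  by_contra hne
  have hpos : 0 < μ.real {x : X | g • x = x} / 2 :=
    half_pos (ENNReal.toReal_pos hne (measure_ne_top _ _))
  set ε := μ.real {x : X | g • x = x} / 2 with hε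
  obtain ⟨n, S, B, hcastle, hopen, hfol, -, hsup⟩ := h {g} ε hpos
  have hcompl : μ.real (Set.univ \ CastleUnion G X S B) < ε := by
    have h1 := (le_iSup (fun μ : {μ : Measure X // InvProb G X μ} =>
      (μ : Measure X) (Set.univ \ CastleUnion G X S B)) ⟨μ, hμ⟩).trans_lt hsup
    exact (ENNReal.lt_ofReal_iff_toReal_lt (measure_ne_top _ _)).mp h1
  let P (i : Fin n) : Finset G := {s ∈ S i | g * s ∉ S i}
  have hP : ∀ i, ((P i).card : ℝ) ≤ ε * (S i).card := fun i => by
    have h1 : (P i).card ≤ (({g} * S i) \ S i).card := by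
      refine Finset.card_le_card_of_injOn (g * ·) (fun s hs => ?_) (mul_right_injective g).injOn
      obtain ⟨h1, h2⟩ := Finset.mem_filter.mp hs
      exact Finset.mem_sdiff.mpr ⟨Finset.mul_mem_mul (Finset.mem_singleton_self g) h1, h2⟩
    have h2 : ((({g} * S i) \ S i).card : ℝ) < ε * (S i).card :=
      isFolner_iff.mp (hfol i)
    exact (Nat.cast_le.mpr h1).trans h2.le
  have hsmul : ∀ i (s : G), μ.real (s • B i) = μ.real (B i) := fun i s => by
    simp only [Measure.real, hμ.measure_smul s (hopen i).measurableSet]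
  have hcover : {x : X | g • x = x} ⊆
      (Set.univ \ CastleUnion G X S B) ∪ ⋃ i, ⋃ s ∈ P i, s • B i := by
    intro x hx
    by_cases hxC : x ∈ CastleUnion G X S B
    · right
      simp only [CastleUnion, Set.mem_iUnion] at hxC ⊢
      obtain ⟨i, s, hs, hxs⟩ := hxC
      refine ⟨i, s, Finset.mem_filter.mpr ⟨hs, fun hgs => ?_⟩, hxs⟩
      refine Set.disjoint_left.mp (hcastle i i s hs _ hgs ?_) hxs ?_
      · simpa using hg
      · rw [mul_smul, ← show g • x = x from hx]
        exact Set.smul_mem_smul_set hxs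
    · exact Or.inl ⟨trivial, hxC⟩
  have htotal : ∑ i, (S i).card * μ.real (B i) ≤ 1 := by
    have h1 : μ.real (⋃ p ∈ Finset.univ.sigma S, p.2 • B p.1) =
        ∑ p ∈ Finset.univ.sigma S, μ.real (p.2 • B p.1) := by
      refine measureReal_biUnion_finset ?_ fun p _ => ((hopen p.1).smul p.2).measurableSet
      rintro ⟨i, s⟩ hs ⟨j, t⟩ ht hne
      simp only [Finset.coe_sigma, Set.mem_sigma_iff, Finset.mem_coe] at hs ht
      exact hcastle i j s hs.2 t ht.2 fun h => hne (by simpa using h)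
    rw [Finset.sum_sigma] at h1
    simp only [hsmul, Finset.sum_const, nsmul_eq_mul] at h1
    rw [← h1]
    exact measureReal_le_one
  have hbd : μ.real (⋃ i, ⋃ s ∈ P i, s • B i) ≤ ε := by
    calc μ.real (⋃ i, ⋃ s ∈ P i, s • B i)
        ≤ ∑ i, μ.real (⋃ s ∈ P i, s • B i) := measureReal_iUnion_fintype_le _
      _ ≤ ∑ i, ∑ s ∈ P i, μ.real (s • B i) :=
          Finset.sum_le_sum fun i _ => measureReal_biUnion_finset_le _ _
      _ = ∑ i, (P i).card * μ.real (B i) := by simp [hsmul]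
      _ ≤ ∑ i, ε * ((S i).card * μ.real (B i)) := Finset.sum_le_sum fun i _ => by
          rw [← mul_assoc]
          exact mul_le_mul_of_nonneg_right (hP i) measureReal_nonneg
      _ = ε * ∑ i, (S i).card * μ.real (B i) := by rw [Finset.mul_sum]
      _ ≤ ε := mul_le_of_le_one_right hpos.le htotal
  have := (measureReal_mono hcover (μ := μ)).trans (measureReal_union_le _ _)
  linarith

theorem ProperAffineCocycle.almostFiniteInMeasure [Countable G] [Infinite G] [CompactSpace X]
    [TotallyDisconnectedSpace X] (c : ProperAffineCocycle G) (hfree : EssFree G X) :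
    AlmostFiniteInMeasure G X := by
  classical
  intro K ε hε
  obtain ⟨L, hL, hfol⟩ := c.exists_isFolner_cell K hε
  obtain ⟨W, hW, hCW, hWε⟩ := exists_isClopen_forall_measure_lt (G := G) (ε := ENNReal.ofReal (ε / 2))
    (C := ⋃ g ∈ (c.ball L).erase 1, {x : X | g • x = x})
    (isClosed_biUnion_finset fun g _ => isClosed_eq (continuous_const_smul g) continuous_id)
    (fun μ hμ => (measure_biUnion_null_iff (Finset.countable_toSet _)).mpr
      fun g hg => hfree g (Finset.ne_of_mem_erase hg) μ hμ)
    (by simpa using hε)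
  obtain ⟨A, hA, hAE, hWA⟩ := exists_isClopen_separated (c.ball L) (V := Wᶜ)
    (by simpa [c.b_one] using hL) (fun g hg => c.inv_mem_ball.mpr hg) hW.compl.isClosed
    (fun g hg hg1 x hx hgx => hx (hCW (Set.mem_iUnion₂.mpr ⟨g, Finset.mem_erase.mpr ⟨hg1, hg⟩, hgx⟩)))
  obtain ⟨f, hf, hfdiam⟩ := exists_isLocallyConstant_fibre (X := X)
    (fun U => ∀ s ∈ c.ball L, ∀ x ∈ U, ∀ y ∈ U, dist (s • x) (s • y) ≤ ε / 2)
    (fun U V hUV h s hs x hx y hy => h s hs x (hUV hx) y (hUV hy)) (fun x => by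
      have hev : ∀ᶠ y in nhds x, ∀ s ∈ c.ball L, dist (s • y) (s • x) < ε / 4 := by
        rw [Filter.eventually_all_finset]
        exact fun s _ => (continuous_const_smul s).continuousAt.eventually
          (Metric.ball_mem_nhds _ (by linarith))
      refine ⟨_, hev, fun s hs y hy z hz => ?_⟩
      have h1 := hy s hs
      have h2 := hz s hs
      have h3 := dist_triangle_right (s • y) (s • z) (s • x)
      linarith)
  let D (x : X) : Set G := {g | g • x ∈ A}
  have hD : ∀ x ∈ A, ∀ d ∈ D x, d ≠ 1 → L < |c.b d| := fun x hx d hd hd1 => by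
    by_contra! hdL
    exact Set.disjoint_left.mp (hAE d (c.mem_ball.mpr hdL) hd1) (Set.smul_mem_smul_set hx) hd
  let τ (x : X) : Finset G × Finset X := (c.cell L (D x), f x)
  have hcell : IsLocallyConstant fun x => c.cell L (D x) := by
    rw [IsLocallyConstant.iff_eventually_eq]
    intro x
    have hev : ∀ᶠ y in nhds x, ∀ d ∈ c.ball L, ∀ g ∈ c.ball L, d * g ∈ D y ↔ d * g ∈ D x := by
      simp only [Filter.eventually_all_finset]
      intro d _ g _
      have hcl : IsClopen {y | d * g ∈ D y} := hA.preimage (continuous_const_smul (d * g))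
      by_cases hx : d * g ∈ D x
      · filter_upwards [hcl.isOpen.mem_nhds hx] with y hy
        exact iff_of_true hy hx
      · filter_upwards [hcl.compl.isOpen.mem_nhds hx] with y hy
        exact iff_of_false hy hx
    filter_upwards [hev] with y hy using ProperAffineCocycle.cell_congr hy
  have hτ : IsLocallyConstant τ := hcell.prodMk hf
  have hfin : (τ '' A).Finite := hτ.range_finite.subset (Set.image_subset_range _ _)
  have : Finite (τ '' A) := hfin
  let e : Fin _ ≃ τ '' A := (Finite.equivFin _).symm
  have hmemD : ∀ {x s}, s ∈ c.cell L (D x) → ∀ y ∈ A, ∀ t, |c.b t| ≤ L → s • x = t • y →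
      c.key s⁻¹ ≤ c.key t⁻¹ := fun {x s} hs y hy t ht hst => by
    refine (ProperAffineCocycle.mem_cell.mp hs).2 _ (by rwa [c.abs_b_inv]) ?_
    change (t⁻¹ * s) • x ∈ A
    rwa [mul_smul, hst, inv_smul_smul]
  refine ⟨_, fun i => (e i).1.1, fun i => A ∩ τ ⁻¹' {(e i).1}, ?_,
    fun i => hA.isOpen.inter (hτ.isOpen_fiber _), fun i => ?_, fun i s hs => ?_, ?_⟩
  · intro i j s hs t ht hne
    rw [Set.disjoint_left]
    rintro _ ⟨x, ⟨hxA, hx⟩, rfl⟩ ⟨y, ⟨hyA, hy⟩, hxy⟩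
    simp only [Set.mem_preimage, Set.mem_singleton_iff] at hx hy hxy
    simp only [← hx] at hs
    simp only [← hy] at ht
    have hsL := (ProperAffineCocycle.mem_cell.mp hs).1
    have htL := (ProperAffineCocycle.mem_cell.mp ht).1
    have hst : s = t := inv_injective <| c.key_injective <|
      (hmemD hs y hyA t htL hxy.symm).antisymm (hmemD ht x hxA s hsL hxy)
    subst hst
    rw [smul_left_cancel_iff] at hxy
    subst hxy
    exact hne (Prod.ext (e.injective (Subtype.ext (hx.symm.trans hy))) rfl)
  · obtain ⟨x, hx, hxe⟩ := (e i).2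
    simp only [← hxe]
    exact hfol _ (hD x hx)
  · obtain ⟨x, hx, hxe⟩ := (e i).2
    simp only [← hxe] at hs ⊢
    refine (Metric.diam_le_of_forall_dist_le (half_pos hε).le ?_).trans_lt (half_lt_self hε)
    rintro _ ⟨y, ⟨-, hy⟩, rfl⟩ _ ⟨z, ⟨-, hz⟩, rfl⟩
    exact hfdiam x s (Finset.mem_filter.mp hs).1 y (congrArg Prod.snd hy) z (congrArg Prod.snd hz)
  · refine (iSup_le fun μ : {μ : Measure X // InvProb G X μ} =>
      (measure_mono (t := W) fun y hy => ?_).trans (hWε μ.1 μ.2).le).trans_lt ((ENNReal.ofReal_lt_ofReal_iff hε).mpr (half_lt_self hε))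
    by_contra hyW
    obtain ⟨g, hg, x, hx, hxy⟩ := Set.mem_iUnion₂.mp (hWA hyW)
    obtain ⟨d, hd, hmin⟩ := ((c.ball L).filter fun d => d • y ∈ A).exists_min_image c.key
      ⟨g⁻¹, Finset.mem_filter.mpr ⟨c.inv_mem_ball.mpr hg, by
        rw [← hxy]
        simpa using hx⟩⟩
    obtain ⟨hdL, hdA⟩ := Finset.mem_filter.mp hd
    rw [ProperAffineCocycle.mem_ball] at hdL
    obtain ⟨i, hi⟩ := e.surjective ⟨τ (d • y), d • y, hdA, rfl⟩
    have hi' : τ (d • y) = (e i).1 := (congrArg Subtype.val hi).symm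
    refine hy.2 (Set.mem_iUnion.mpr ⟨i, Set.mem_iUnion₂.mpr
      ⟨d⁻¹, ?_, d • y, ⟨hdA, hi'⟩, inv_smul_smul d y⟩⟩)
    simp only [← hi']
    refine ProperAffineCocycle.mem_cell.mpr ⟨by rwa [c.abs_b_inv], fun d' hd' hmem => ?_⟩
    rw [inv_inv]
    refine hmin d' (Finset.mem_filter.mpr ⟨c.mem_ball.mpr hd', ?_⟩)
    have : (d' * d⁻¹) • d • y ∈ A := hmem
    rwa [mul_smul, inv_smul_smul] at this

end AlmostFinite

/-- If the orbit space of a countable subgroup `F` is Hausdorff, then essential freeness forces `F`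
to be finite as soon as there is an invariant measure. -/
theorem Paper.EssFree.finite_of_t2Space_quotient {G X : Type*} [Group G] [TopologicalSpace X]
    [T2Space X] [CompactSpace X] [MulAction G X] [ContinuousConstSMul G X] [MeasurableSpace X]
    (hfree : EssFree G X)
    (F : Subgroup G) [Countable F] (hT2 : T2Space (Quotient (MulAction.orbitRel F X)))
    {μ : Measure X} (hμ : InvProb G X μ) : Finite F := by
  have hprob := hμ.1
  have hnull : μ (⋃ g : {g : F // g ≠ 1}, {x : X | g.1 • x = x}) = 0 :=
    measure_iUnion_null fun g => hfree g.1 (by simpa using g.2) μ hμ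
  obtain ⟨x, hx⟩ : ∃ x, x ∉ ⋃ g : {g : F // g ≠ 1}, {x : X | g.1 • x = x} := by
    by_contra! h
    rw [Set.eq_univ_of_forall h, measure_univ] at hnull
    exact one_ne_zero hnull
  have : ContinuousConstSMul F X := ⟨fun g => continuous_const_smul (g : G)⟩
  refine finite_of_isClosed_orbit x (fun g hg => ?_) ?_
  · by_contra hg1
    exact hx (Set.mem_iUnion.mpr ⟨⟨g, hg1⟩, hg⟩)
  · have h1 : IsClosed ({Quotient.mk _ x} : Set (Quotient (MulAction.orbitRel F X))) :=
      isClosed_singleton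
    convert h1.preimage continuous_quotient_mk'
    ext y
    simp only [Set.mem_preimage, Set.mem_singleton_iff]
    exact MulAction.orbitRel_apply.symm.trans Quotient.eq.symm

theorem afInMeasure_iff_essFree_cantor
    (Γ : Type*) [Group Γ] [Countable Γ]
    (F : Subgroup Γ) [F.Normal] (hlf : LocallyFiniteGroup F)
    (hQ : VirtuallyZ (Γ ⧸ F))
    (X : Type*) [MetricSpace X] [CompactSpace X] [Nonempty X]
    [TotallyDisconnectedSpace X]
    [MeasurableSpace X] [BorelSpace X]
    [MulAction Γ X] [ContinuousConstSMul Γ X]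
    (hperf : Perfect (Set.univ : Set X))
    (hmin : Minimal Γ X)
    (hT2 : T2Space (Quotient (MulAction.orbitRel F X))) :
    AlmostFiniteInMeasure Γ X ↔ EssFree Γ X := by
  refine ⟨AlmostFiniteInMeasure.essFree, fun hfree => ?_⟩
  by_cases hM : ∃ μ : Measure X, InvProb Γ X μ
  · obtain ⟨μ, hμ⟩ := hM
    have hF : Finite F := hfree.finite_of_t2Space_quotient F hT2 hμ
    have : Infinite (Γ ⧸ F) := hQ.infinite
    have : Infinite Γ := Infinite.of_surjective _ (QuotientGroup.mk'_surjective F)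
    obtain ⟨c⟩ := hQ.nonempty_properAffineCocycle
    refine (c.comap (QuotientGroup.mk' F) fun q => ?_).almostFiniteInMeasure hfree
    obtain ⟨g, rfl⟩ := QuotientGroup.mk'_surjective F q
    refine ((Set.toFinite (F : Set Γ)).image (g * ·)).subset fun h hh => ?_
    exact ⟨g⁻¹ * h, QuotientGroup.eq.mp (Eq.symm hh), mul_inv_cancel_left g h⟩
  · intro K ε hε
    refine ⟨0, Fin.elim0, Fin.elim0, fun i => i.elim0, fun i => i.elim0, fun i => i.elim0,
      fun i => i.elim0, ?_⟩
    have : IsEmpty {μ : Measure X // InvProb Γ X μ} := ⟨fun μ => hM ⟨μ.1, μ.2⟩⟩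
    simpa using hε
end

section
/- Every minimal continuous action of the infinite dihedral group D∞ on an infinite compact metrizable space X with the small boundary property is almost finite. -/
open scoped Pointwise
open MeasureTheory

open Paper

namespace DihedralAction

open Filter Topology
open Finset (range)

/-- The rotation `s ^ k` in the infinite dihedral group. -/
def rot (k : ℤ) : DihedralGroup 0 := DihedralGroup.r k

/-- The reflection `t * s ^ k` in the infinite dihedral group. -/
def ref (k : ℤ) : DihedralGroup 0 := DihedralGroup.sr k

lemma rot_mul_rot (a b : ℤ) : rot a * rot b = rot (a + b) := rfl
lemma rot_mul_ref (a b : ℤ) : rot a * ref b = ref (b - a) := rfl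
lemma ref_mul_rot (a b : ℤ) : ref a * rot b = ref (a + b) := rfl
lemma ref_mul_ref (a b : ℤ) : ref a * ref b = rot (b - a) := rfl
lemma rot_zero : rot 0 = 1 := rfl

lemma rot_injective : Function.Injective rot := fun _ _ h => DihedralGroup.r.inj h
lemma ref_injective : Function.Injective ref := fun _ _ h => DihedralGroup.sr.inj h
lemma rot_ne_ref (a b : ℤ) : rot a ≠ ref b := fun h => by
  unfold rot ref at h
  injection h

lemma exists_eq_rot_or_ref (g : DihedralGroup 0) : ∃ k : ℤ, g = rot k ∨ g = ref k := by
  rcases g with k | k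
  · exact ⟨k, Or.inl rfl⟩
  · exact ⟨k, Or.inr rfl⟩

section Action

variable {X : Type*} [MulAction (DihedralGroup 0) X]

lemma rot_smul_rot (a b : ℤ) (x : X) : rot a • rot b • x = rot (a + b) • x := by
  rw [smul_smul, rot_mul_rot]
lemma rot_smul_ref (a b : ℤ) (x : X) : rot a • ref b • x = ref (b - a) • x := by
  rw [smul_smul, rot_mul_ref]
lemma ref_smul_rot (a b : ℤ) (x : X) : ref a • rot b • x = ref (a + b) • x := by
  rw [smul_smul, ref_mul_rot]
lemma ref_smul_ref (a b : ℤ) (x : X) : ref a • ref b • x = rot (b - a) • x := by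
  rw [smul_smul, ref_mul_ref]
lemma rot_zero_smul (x : X) : rot 0 • x = x := by
  rw [rot_zero, one_smul]

lemma ref_smul_ref_self (a : ℤ) (x : X) : ref a • ref a • x = x := by
  rw [ref_smul_ref, sub_self, rot_zero_smul]

lemma ref_smul_rot_smul_eq_iff (a j : ℤ) (x : X) :
    ref a • rot j • x = rot j • x ↔ ref (a + 2 * j) • x = x := by
  rw [← smul_left_cancel_iff (rot (-j)), ref_smul_rot, rot_smul_ref, rot_smul_rot, neg_add_cancel,
    rot_zero_smul]
  ring_nf

/-- The number of visits to `U` along the first `N` points of the rotation orbit of `x`. -/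
noncomputable def visits (U : Set X) (N : ℕ) (x : X) : ℝ :=
  ∑ p ∈ range N, U.indicator (fun _ => (1 : ℝ)) (rot (p : ℤ) • x)

/-- Every long enough orbit segment visits `U` with frequency at most `η`. -/
def Sparse (U : Set X) (η : ℝ) : Prop :=
  ∃ N₀ : ℕ, ∀ N ≥ N₀, ∀ x : X, visits U N x ≤ η * N

end Action

lemma abs_sum_shift_sub_le (h : ℤ → ℝ) (C : ℝ) (hC : ∀ p, |h p| ≤ C) (N : ℕ) (a : ℤ) :
    |∑ p ∈ range N, h (p + a) - ∑ p ∈ range N, h p| ≤ 2 * C * |a| := by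
  have step : ∀ b : ℤ, |∑ p ∈ range N, h (p + (b + 1)) - ∑ p ∈ range N, h (p + b)| ≤ 2 * C := by
    intro b
    have := Finset.sum_range_sub (fun p : ℕ => h (p + b)) N
    rw [Finset.sum_sub_distrib] at this
    have e : ∑ p ∈ range N, h (p + (b + 1)) = ∑ p ∈ range N, h (((p + 1 : ℕ) : ℤ) + b) := by
      refine Finset.sum_congr rfl fun p _ => ?_
      congr 1; push_cast; ring
    rw [e, this]
    have h1 := abs_le.1 (hC ((N : ℤ) + b))
    have h2 := abs_le.1 (hC (((0 : ℕ) : ℤ) + b))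
    rw [abs_le]; constructor <;> linarith
  induction a using Int.induction_on with
  | zero => simp
  | succ i ih =>
    have := step i
    have e : ((|(i : ℤ) + 1| : ℤ) : ℝ) = ((|(i : ℤ)| : ℤ) : ℝ) + 1 := by
      rw [abs_of_nonneg (by positivity), abs_of_nonneg (by positivity)]; push_cast; ring
    rw [e]
    rw [abs_le] at *; constructor <;> linarith
  | pred i ih =>
    have := step (-i - 1)
    have e : ((|-(i : ℤ) - 1| : ℤ) : ℝ) = ((|-(i : ℤ)| : ℤ) : ℝ) + 1 := by
      rw [abs_of_nonpos (by omega), abs_of_nonpos (by omega)]; push_cast; ring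
    rw [e]
    rw [sub_add_cancel] at this
    rw [abs_le] at *; constructor <;> linarith

section Measure

variable {X : Type*} [MulAction (DihedralGroup 0) X] [MeasurableSpace X]

open scoped ENNReal BoundedContinuousFunction

/-- The empirical measure of the two orbit segments of length `N` issued from `x`. -/
noncomputable def empirical (N : ℕ) (x : X) : Measure X :=
  (2 * N : ℝ≥0∞)⁻¹ • ∑ p ∈ range N, (Measure.dirac (rot p • x) + Measure.dirac (ref p • x))

lemma isProbabilityMeasure_empirical {N : ℕ} (hN : N ≠ 0) (x : X) :
    IsProbabilityMeasure (empirical N x) := by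
  constructor
  have h : ((N : ℝ≥0∞)) ≠ 0 := by exact_mod_cast hN
  simp only [empirical, Measure.smul_apply, Measure.finsetSum_apply, Measure.add_apply,
    measure_univ, Finset.sum_const, Finset.card_range, smul_eq_mul, nsmul_eq_mul]
  rw [one_add_one_eq_two, mul_comm (N : ℝ≥0∞) 2]
  exact ENNReal.inv_mul_cancel (by simp [h]) (ENNReal.mul_ne_top (by simp) (by simp))

lemma visits_le_empirical {N : ℕ} (hN : N ≠ 0) (x : X) {U : Set X} (hU : MeasurableSet U) :
    visits U N x / (2 * N) ≤ (empirical N x).real U := by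
  have hN' : (0 : ℝ) < N := by exact_mod_cast Nat.pos_of_ne_zero hN
  rw [empirical, measureReal_ennreal_smul_apply, div_eq_inv_mul]
  simp only [ENNReal.toReal_inv, ENNReal.toReal_mul, ENNReal.toReal_ofNat, ENNReal.toReal_natCast]
  gcongr
  rw [visits, measureReal_def, Measure.finsetSum_apply, ENNReal.toReal_sum]
  · refine Finset.sum_le_sum fun p _ => ?_
    rw [Measure.add_apply, Measure.dirac_apply' _ hU, Measure.dirac_apply' _ hU,
      ENNReal.toReal_add]
    · by_cases h : rot (p : ℤ) • x ∈ U <;> simp [h]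
    · by_cases h : rot (p : ℤ) • x ∈ U <;> simp [h]
    · by_cases h : ref (p : ℤ) • x ∈ U <;> simp [h]
  · intro p _
    finiteness

variable [MetricSpace X] [CompactSpace X] [BorelSpace X]

lemma integral_empirical (N : ℕ) (x : X) (f : X →ᵇ ℝ) :
    ∫ y, f y ∂(empirical N x) =
      (2 * N : ℝ)⁻¹ * ∑ p ∈ range N, (f (rot p • x) + f (ref p • x)) := by
  have hi : ∀ y : X, Integrable f (Measure.dirac y) := fun y => f.integrable _
  rw [empirical, integral_smul_measure, integral_finsetSum_measure]
  · simp only [ENNReal.toReal_inv, ENNReal.toReal_mul, ENNReal.toReal_ofNat, ENNReal.toReal_natCast,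
      smul_eq_mul]
    congr 1
    refine Finset.sum_congr rfl fun p _ => ?_
    rw [integral_add_measure (hi _) (hi _), integral_dirac, integral_dirac]
  · intro p _
    exact (hi _).add_measure (hi _)

lemma abs_integral_empirical_smul_sub_le [ContinuousConstSMul (DihedralGroup 0) X]
    (f : X →ᵇ ℝ) (γ : DihedralGroup 0) :
    ∃ C : ℝ, ∀ (N : ℕ) (x : X),
      |∫ y, f (γ • y) ∂(empirical N x) - ∫ y, f y ∂(empirical N x)| ≤ (2 * N : ℝ)⁻¹ * C := by
  let g : X →ᵇ ℝ := f.compContinuous ⟨fun y => γ • y, continuous_const_smul γ⟩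
  have hg : ∀ y, g y = f (γ • y) := fun y => rfl
  have hb : ∀ y, |f y| ≤ ‖f‖ := fun y => f.norm_coe_le_norm y
  obtain ⟨a, rfl | rfl⟩ := exists_eq_rot_or_ref γ
  · refine ⟨2 * ‖f‖ * |a| + 2 * ‖f‖ * |(-a : ℤ)|, fun N x => ?_⟩
    have h1 := abs_sum_shift_sub_le (fun p => f (rot p • x)) ‖f‖ (fun _ => hb _) N a
    have h2 := abs_sum_shift_sub_le (fun p => f (ref p • x)) ‖f‖ (fun _ => hb _) N (-a)
    simp only [← hg]
    rw [integral_empirical, integral_empirical, ← mul_sub, abs_mul, abs_of_nonneg (by positivity)]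
    gcongr
    simp only [hg, rot_smul_rot, rot_smul_ref, Finset.sum_add_distrib]
    simp only [add_comm a, sub_eq_add_neg] at *
    rw [abs_le] at *
    constructor <;> linarith
  · refine ⟨2 * ‖f‖ * |a| + 2 * ‖f‖ * |(-a : ℤ)|, fun N x => ?_⟩
    have h1 := abs_sum_shift_sub_le (fun p => f (ref p • x)) ‖f‖ (fun _ => hb _) N a
    have h2 := abs_sum_shift_sub_le (fun p => f (rot p • x)) ‖f‖ (fun _ => hb _) N (-a)
    simp only [← hg]
    rw [integral_empirical, integral_empirical, ← mul_sub, abs_mul, abs_of_nonneg (by positivity)]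
    gcongr
    simp only [hg, ref_smul_rot, ref_smul_ref, Finset.sum_add_distrib]
    simp only [add_comm a, sub_eq_add_neg] at *
    rw [abs_le] at *
    constructor <;> linarith

lemma exists_isOpen_sparse [ContinuousConstSMul (DihedralGroup 0) X] {F : Set X}
    (hF : IsClosed F) (hnull : ∀ μ : Measure X, InvProb (DihedralGroup 0) X μ → μ F = 0)
    {η : ℝ} (hη : 0 < η) : ∃ U : Set X, IsOpen U ∧ F ⊆ U ∧ Sparse U η := by
  by_contra! hcon
  have hex : ∀ k : ℕ, ∃ (N : ℕ) (x : X), k + 1 ≤ N ∧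
      η * N < visits (Metric.thickening (1 / ((k : ℝ) + 1)) F) N x := by
    intro k
    have := hcon _ (Metric.isOpen_thickening (δ := 1 / ((k : ℝ) + 1)) (E := F))
      (Metric.self_subset_thickening (by positivity) F)
    simp only [Sparse] at this
    push Not at this
    obtain ⟨N, hN, x, hx⟩ := this (k + 1)
    exact ⟨N, x, hN, hx⟩
  choose N x hN hx using hex
  have hN0 : ∀ k, N k ≠ 0 := fun k => by have := hN k; omega
  let μs : ℕ → ProbabilityMeasure X := fun k =>
    ⟨empirical (N k) (x k), isProbabilityMeasure_empirical (hN0 k) (x k)⟩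
  obtain ⟨ν, hν⟩ : ∃ ν : ProbabilityMeasure X, Tendsto μs (hyperfilter ℕ : Filter ℕ) (𝓝 ν) := by
    have : Nonempty (ProbabilityMeasure X) := ⟨μs 0⟩
    exact ⟨_, (Ultrafilter.map μs (hyperfilter ℕ)).le_nhds_lim⟩
  have hNlim : Tendsto (fun k => (2 * (N k : ℝ))⁻¹) (hyperfilter ℕ : Filter ℕ) (𝓝 0) := by
    have h1 : Tendsto (fun k => (N k : ℝ)) atTop atTop :=
      tendsto_natCast_atTop_atTop.comp
        (tendsto_atTop_mono (fun k => (Nat.le_succ k).trans (hN k)) tendsto_id)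
    exact ((h1.const_mul_atTop two_pos).inv_tendsto_atTop).mono_left
      Nat.hyperfilter_le_atTop
  have hweak := ProbabilityMeasure.tendsto_iff_forall_integral_tendsto.1 hν
  have hinv : InvProb (DihedralGroup 0) X (ν : Measure X) := by
    refine ⟨inferInstance, fun γ => ?_⟩
    have hm : Measurable (fun y : X => γ • y) := (continuous_const_smul γ).measurable
    have : IsProbabilityMeasure (Measure.map (fun y : X => γ • y) (ν : Measure X)) :=
      Measure.isProbabilityMeasure_map hm.aemeasurable
    refine ext_of_forall_integral_eq_of_IsFiniteMeasure fun f => ?_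
    rw [integral_map hm.aemeasurable f.continuous.aestronglyMeasurable]
    obtain ⟨C, hC⟩ := abs_integral_empirical_smul_sub_le f γ
    have h1 := hweak (f.compContinuous ⟨fun y => γ • y, continuous_const_smul γ⟩)
    have h2 := h1.sub (hweak f)
    have h3 : Tendsto (fun k => (2 * (N k : ℝ))⁻¹ * C) (hyperfilter ℕ : Filter ℕ) (𝓝 0) := by
      simpa using hNlim.mul_const C
    have h4 : Tendsto (fun k => ∫ y, f (γ • y) ∂(empirical (N k) (x k)) -
        ∫ y, f y ∂(empirical (N k) (x k))) (hyperfilter ℕ : Filter ℕ) (𝓝 0) :=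
      squeeze_zero_norm (fun k => hC (N k) (x k)) h3
    exact sub_eq_zero.1 (tendsto_nhds_unique h2 h4)
  have hlow : ∀ δ : ℝ, 0 < δ →
      ENNReal.ofReal (η / 2) ≤ (ν : Measure X) (Metric.cthickening δ F) := by
    intro δ hδ
    refine le_trans ?_ (ProbabilityMeasure.limsup_measure_closed_le_of_tendsto hν
      Metric.isClosed_cthickening)
    refine le_limsup_of_frequently_le (Eventually.frequently ?_)
    have hev : ∀ᶠ k : ℕ in (hyperfilter ℕ : Filter ℕ), 1 / ((k : ℝ) + 1) < δ :=
      Nat.hyperfilter_le_atTop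
        ((tendsto_one_div_add_atTop_nhds_zero_nat (𝕜 := ℝ)).eventually_lt_const hδ)
    filter_upwards [hev] with k hk
    have := isProbabilityMeasure_empirical (hN0 k) (x k)
    have hpos : (0 : ℝ) < N k := by exact_mod_cast Nat.pos_of_ne_zero (hN0 k)
    rw [ENNReal.ofReal_le_iff_le_toReal (measure_ne_top _ _)]
    calc η / 2 ≤ visits (Metric.thickening (1 / ((k : ℝ) + 1)) F) (N k) (x k) / (2 * N k) := by
          rw [le_div_iff₀ (by positivity)]
          linarith [hx k]
      _ ≤ (empirical (N k) (x k)).real (Metric.thickening (1 / ((k : ℝ) + 1)) F) :=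
          visits_le_empirical (hN0 k) (x k) Metric.isOpen_thickening.measurableSet
      _ ≤ (empirical (N k) (x k)).real (Metric.cthickening δ F) :=
          measureReal_mono ((Metric.thickening_subset_cthickening _ _).trans
            (Metric.cthickening_mono hk.le _))
  have hlim := tendsto_measure_cthickening_of_isClosed (μ := (ν : Measure X)) (s := F)
    ⟨1, one_pos, measure_ne_top _ _⟩ hF
  rw [hnull _ hinv] at hlim
  have := ge_of_tendsto (hlim.mono_left (nhdsWithin_le_nhds (s := Set.Ioi 0)))
    (eventually_mem_nhdsWithin.mono fun δ hδ => hlow δ hδ)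
  have h2 := ENNReal.ofReal_pos.2 (half_pos hη)
  exact absurd (lt_of_lt_of_le h2 this) (lt_irrefl _)

end Measure

section Queue

variable {X : Type*} [MetricSpace X] [CompactSpace X]
  [MulAction (DihedralGroup 0) X] [ContinuousConstSMul (DihedralGroup 0) X]

/-- A closed set `C` is subordinate to an open set `O` as soon as a continuous function `a ≥ 1_C`
has smaller sums than a continuous function `o ≤ 1_O / 2` along all orbit segments of some length.
The points of `C` are served by those of `O` as in a first-in-first-out queue. -/
theorem subord_of_sum_lt {C O : Set X} (hC : IsClosed C) (a o : C(X, ℝ))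
    (ha0 : ∀ x, 0 ≤ a x) (ha1 : ∀ x ∈ C, a x = 1) (ho0 : ∀ x, 0 ≤ o x) (ho1 : ∀ x, o x ≤ 1 / 2)
    (hoO : ∀ x, o x ≠ 0 → x ∈ O) (N : ℕ)
    (hN : ∀ x, ∑ p ∈ range N, a (rot p • x) < ∑ p ∈ range N, o (rot p • x)) :
    Subord (DihedralGroup 0) X C O := by
  rcases isEmpty_or_nonempty X with hX | hX
  · exact ⟨0, Fin.elim0, Fin.elim0, fun k => k.elim0, fun x _ => isEmptyElim x,
      fun k => k.elim0, fun k => k.elim0⟩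
  have hN0 : 0 < N := by
    rcases Nat.eq_zero_or_pos N with rfl | h
    · simpa using hN hX.some
    · exact h
  have hne : (range N).Nonempty := ⟨0, Finset.mem_range.2 hN0⟩
  have hcont : ∀ k : ℤ, Continuous fun x : X => rot k • x := fun k => continuous_const_smul _
  let S : ℕ → X → ℝ := fun n x => ∑ i ∈ range n, (a (rot (i + 1) • x) - o (rot (i + 1) • x))
  let Q : X → ℝ := fun x => (range N).sup' hne fun n => S n x
  let T : ℕ → X → ℝ := fun k x => ∑ i ∈ range k, o (rot (-i) • x)
  have hScont : ∀ n, Continuous (S n) := fun n => continuous_finsetSum _ fun i _ =>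
    (a.continuous.comp (hcont _)).sub (o.continuous.comp (hcont _))
  have hTcont : ∀ n, Continuous (T n) := fun n => continuous_finsetSum _ fun i _ =>
    o.continuous.comp (hcont _)
  have hQcont : Continuous Q := Continuous.finset_sup'_apply hne fun n _ => hScont n
  have hQ0 : ∀ x, 0 ≤ Q x := fun x => by
    have h0 : S 0 x = 0 := Finset.sum_range_zero _
    exact h0 ▸ Finset.le_sup' (fun n => S n x) (Finset.mem_range.2 hN0)
  have hQ1 : ∀ x, Q x + a x - o x ≤ Q (rot (-1) • x) := by
    intro x
    have hS : ∀ n, S (n + 1) (rot (-1) • x) = S n x + a x - o x := by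
      intro n
      simp only [S, Finset.sum_range_succ', rot_smul_rot]
      simp [rot_zero_smul]
      ring
    obtain ⟨n, hn, hQn⟩ := Finset.exists_mem_eq_sup' hne fun n => S n x
    have hQn' : Q x = S n x := hQn
    rw [hQn', ← hS]
    rcases (Nat.succ_le_of_lt (Finset.mem_range.1 hn)).lt_or_eq with h | h
    · exact Finset.le_sup' (fun n => S n (rot (-1) • x)) (Finset.mem_range.2 h)
    · refine le_trans (le_of_lt ?_) (hQ0 _)
      change S (n.succ) _ < 0
      rw [h]
      simp only [S, Finset.sum_sub_distrib, rot_smul_rot]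
      simpa [rot_zero_smul] using hN x
  have hQj : ∀ (j : ℕ) (x : X), 0 < j → Q x + a x - T j x ≤ Q (rot (-j) • x) := by
    intro j x hj
    induction j, hj using Nat.le_induction with
    | base => simpa [T, rot_zero_smul] using hQ1 x
    | succ j hj ih =>
      have h := hQ1 (rot (-j) • x)
      rw [rot_smul_rot] at h
      have e : (-1 + -(j : ℤ)) = -((j + 1 : ℕ) : ℤ) := by push_cast; ring
      rw [e] at h
      have hT : T (j + 1) x = T j x + o (rot (-j) • x) := Finset.sum_range_succ _ _
      have := ha0 (rot (-j) • x)
      linarith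
  have hTadd : ∀ (j k : ℕ) (x : X), T (j + k) x = T j x + T k (rot (-j) • x) := by
    intro j k x
    simp only [T, Finset.sum_range_add, rot_smul_rot]
    congr 1
    refine Finset.sum_congr rfl fun i _ => ?_
    congr 3; push_cast; ring
  obtain ⟨η, hη, hTη⟩ : ∃ η : ℝ, 0 < η ∧ ∀ x, η ≤ T N x := by
    obtain ⟨x₀, -, hx₀⟩ := isCompact_univ.exists_isMinOn Set.univ_nonempty
      (hTcont N).continuousOn
    refine ⟨T N x₀, ?_, fun x => hx₀ (Set.mem_univ x)⟩
    have h := hN (rot (-(N - 1 : ℕ)) • x₀)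
    have h0 : 0 ≤ ∑ p ∈ range N, a (rot p • rot (-(N - 1 : ℕ)) • x₀) :=
      Finset.sum_nonneg fun _ _ => ha0 _
    refine lt_of_le_of_lt h0 (h.trans_eq ?_)
    rw [← Finset.sum_range_reflect]
    refine Finset.sum_congr rfl fun i hi => ?_
    rw [rot_smul_rot]
    have := Finset.mem_range.1 hi
    congr 3; omega
  have hTM : ∀ (M : ℕ) (x : X), M * η ≤ T (N * M) x := by
    intro M x
    induction M with
    | zero => simp [T]
    | succ M ih =>
      rw [Nat.mul_succ, hTadd]
      have := hTη (rot (-(N * M : ℕ)) • x)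
      push_cast at this ⊢
      linarith
  let W : ℕ → Set X := fun k =>
    {x | 3 / 4 < a x ∧ T k x - 1 / 4 < Q x ∧ Q x < T (k + 1) x ∧ 0 < o (rot (-k) • x)}
  have hWopen : ∀ k, IsOpen (W k) := fun k =>
    (isOpen_lt continuous_const a.continuous).inter <|
      (isOpen_lt ((hTcont k).sub continuous_const) hQcont).inter <|
      (isOpen_lt hQcont (hTcont _)).inter <|
      isOpen_lt continuous_const (o.continuous.comp (hcont _))
  have hcover : C ⊆ ⋃ k, W k := by
    intro x hx
    have hex : ∃ k, Q x < T (k + 1) x := by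
      obtain ⟨M, hM⟩ := exists_nat_gt (Q x / η)
      rw [div_lt_iff₀ hη] at hM
      refine ⟨N * M, ?_⟩
      have h1 := hTM M x
      have h2 : T (N * M + 1) x = T (N * M) x + _ := Finset.sum_range_succ _ _
      have := ho0 (rot (-(N * M : ℕ)) • x)
      linarith
    classical
    have hk := Nat.find_spec hex
    have hmin : T (Nat.find hex) x ≤ Q x := by
      rcases hn : Nat.find hex with _ | n
      · simpa [T] using hQ0 x
      · exact not_lt.1 (Nat.find_min hex (m := n) (by omega))
    have h2 : T (Nat.find hex + 1) x = T (Nat.find hex) x + _ := Finset.sum_range_succ _ _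
    refine Set.mem_iUnion.2 ⟨Nat.find hex, ?_, ?_, hk, ?_⟩
    · rw [ha1 x hx]; norm_num
    · linarith
    · linarith
  have hkey : ∀ (k j : ℕ) (x : X), 0 < j → x ∈ W (k + j) → rot (-j) • x ∈ W k → False := by
    intro k j x hj hx hx'
    obtain ⟨hx1, hx2, -, -⟩ := hx
    obtain ⟨-, -, hx3, -⟩ := hx'
    have h1 := hQj j x hj
    have h2 := hTadd j k x
    have h3 : T (k + 1) (rot (-j) • x) = T k (rot (-j) • x) + _ := Finset.sum_range_succ _ _
    have h4 := ho1 (rot (-k) • rot (-j) • x)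
    rw [add_comm k j] at hx2
    linarith
  obtain ⟨t, ht⟩ := hC.isCompact.elim_finite_subcover W hWopen hcover
  have hlt : ∀ k l : ℕ, k < l → Disjoint (rot (-l) • W l) (rot (-k) • W k) := by
    intro k l hkl
    rw [Set.disjoint_left]
    rintro _ ⟨x, hx, rfl⟩ ⟨x', hx', he⟩
    obtain ⟨j, rfl⟩ := Nat.exists_eq_add_of_lt hkl
    refine hkey k (j + 1) x (Nat.succ_pos _) hx ?_
    have : x' = rot (-((j + 1 : ℕ) : ℤ)) • x := by
      have := congrArg (fun z => rot k • z) he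
      simp only [rot_smul_rot, add_neg_cancel, rot_zero_smul] at this
      rw [this]; congr 2; push_cast; ring
    rwa [← this]
  refine ⟨t.sup id + 1, fun k => W k, fun k => rot (-(k : ℕ)), fun k => hWopen k, ?_, ?_, ?_⟩
  · intro x hx
    obtain ⟨k, hk, hxk⟩ := Set.mem_iUnion₂.1 (ht hx)
    exact Set.mem_iUnion.2 ⟨⟨k, Nat.lt_succ_of_le (Finset.le_sup (f := id) hk)⟩, hxk⟩
  · rintro k _ ⟨x, hx, rfl⟩
    exact hoO _ hx.2.2.2.ne'
  · intro k l hkl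
    rcases lt_or_gt_of_ne (Fin.val_ne_of_ne hkl) with h | h
    · exact (hlt _ _ h).symm
    · exact hlt _ _ h

end Queue

section NullClosed

variable {X : Type*} [MetricSpace X] [MulAction (DihedralGroup 0) X]
  [MeasurableSpace X]

/-- A closed set that is null for every invariant probability measure. -/
def NullClosed (F : Set X) : Prop :=
  IsClosed F ∧ ∀ μ : Measure X, InvProb (DihedralGroup 0) X μ → μ F = 0

lemma NullClosed.union {F F' : Set X} (h : NullClosed F) (h' : NullClosed F') :
    NullClosed (F ∪ F') :=
  ⟨h.1.union h'.1, fun μ hμ => measure_union_null (h.2 μ hμ) (h'.2 μ hμ)⟩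

lemma nullClosed_iUnion {ι : Type*} [Finite ι] {F : ι → Set X} (h : ∀ i, NullClosed (F i)) :
    NullClosed (⋃ i, F i) :=
  ⟨isClosed_iUnion_of_finite fun i => (h i).1,
    fun μ hμ => measure_iUnion_null fun i => (h i).2 μ hμ⟩

end NullClosed

section Freeness

variable {X : Type*} [MetricSpace X] [MulAction (DihedralGroup 0) X]

lemma rot_smul_ne [Infinite X] (hmin : Minimal (DihedralGroup 0) X) {j : ℤ} (hj : j ≠ 0) (x : X) :
    rot j • x ≠ x := by
  intro h
  have hmul : ∀ q : ℤ, rot (j * q) • x = x := by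
    intro q
    induction q using Int.induction_on with
    | zero => rw [mul_zero, rot_zero_smul]
    | succ i ih => rw [mul_add, mul_one, ← rot_smul_rot, h, ih]
    | pred i ih =>
      rw [mul_sub, mul_one, sub_eq_add_neg, add_comm, ← rot_smul_rot, ih]
      nth_rewrite 1 [← h]
      rw [rot_smul_rot, neg_add_cancel, rot_zero_smul]
  have hmod : ∀ i : ℤ, i % j ∈ Set.Ico 0 |j| := fun i =>
    ⟨Int.emod_nonneg i hj, Int.emod_lt_abs i hj⟩
  have hfin : (MulAction.orbit (DihedralGroup 0) x).Finite := by
    refine (((Set.finite_Ico 0 |j|).image fun i => rot i • x).union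
      ((Set.finite_Ico 0 |j|).image fun i => ref i • x)).subset ?_
    rintro _ ⟨g, rfl⟩
    obtain ⟨i, rfl | rfl⟩ := exists_eq_rot_or_ref g
    · refine Or.inl ⟨i % j, hmod i, ?_⟩
      change rot (i % j) • x = rot i • x
      conv_rhs => rw [← Int.emod_add_mul_ediv i j, ← rot_smul_rot, hmul]
    · refine Or.inr ⟨i % j, hmod i, ?_⟩
      change ref (i % j) • x = ref i • x
      conv_rhs => rw [← Int.emod_add_mul_ediv i j, ← ref_smul_rot, hmul]
  have huniv := (hmin x).closure_eq
  rw [hfin.isClosed.closure_eq] at huniv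
  exact Set.infinite_univ (huniv ▸ hfin)

lemma eq_of_ref_smul_eq [Infinite X] (hmin : Minimal (DihedralGroup 0) X) {a b : ℤ} {x : X}
    (ha : ref a • x = x) (hb : ref b • x = x) : a = b := by
  by_contra hab
  refine rot_smul_ne hmin (sub_ne_zero.2 (Ne.symm hab)) x ?_
  rw [← ref_smul_ref, hb, ha]

lemma exists_forall_ref_smul_ne [Infinite X] (hmin : Minimal (DihedralGroup 0) X) (L : ℕ) :
    ∃ x : X, ∀ i : ℤ, |i| ≤ L → ref i • x ≠ x := by
  obtain ⟨x⟩ : Nonempty X := inferInstance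
  by_cases hx : ∃ k : ℤ, ref k • x = x
  · obtain ⟨k, hk⟩ := hx
    refine ⟨rot (-(|k| + L + 1)) • x, fun i hi h => ?_⟩
    rw [ref_smul_rot_smul_eq_iff] at h
    have h1 := eq_of_ref_smul_eq hmin h hk
    have h2 := abs_le.1 hi
    have h3 := neg_abs_le k
    have h4 := abs_nonneg k
    omega
  · push Not at hx
    exact ⟨x, fun i _ => hx i⟩

variable [ContinuousConstSMul (DihedralGroup 0) X]

lemma eventually_disjoint_smul {g : DihedralGroup 0} {x : X} (h : g • x ≠ x) :
    ∀ᶠ U in (𝓝 x).smallSets, Disjoint (g • U) U := by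
  obtain ⟨A, B, hA, hB, hgx, hx, hAB⟩ := t2_separation h
  refine eventually_smallSets.2 ⟨B ∩ (fun y => g • y) ⁻¹' A, ?_, fun U hU => ?_⟩
  · exact Filter.inter_mem (hB.mem_nhds hx)
      ((continuous_const_smul g).continuousAt.preimage_mem_nhds (hA.mem_nhds hgx))
  · refine hAB.mono ?_ fun y hy => (hU hy).1
    rintro _ ⟨y, hy, rfl⟩
    exact (hU hy).2

lemma eventually_diam_smul_lt (g : DihedralGroup 0) (x : X) {ε : ℝ} (hε : 0 < ε) :
    ∀ᶠ U in (𝓝 x).smallSets, Metric.diam (g • U) < ε := by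
  refine eventually_smallSets.2 ⟨(fun y => g • y) ⁻¹' Metric.ball (g • x) (ε / 3), ?_,
    fun U hU => ?_⟩
  · exact (continuous_const_smul g).continuousAt.preimage_mem_nhds
      (Metric.ball_mem_nhds _ (by positivity))
  · have hsub : g • U ⊆ Metric.ball (g • x) (ε / 3) := by
      rintro _ ⟨y, hy, rfl⟩
      exact hU hy
    have h1 := Metric.diam_mono hsub Metric.isBounded_ball
    have h2 := Metric.diam_ball (x := g • x) (r := ε / 3) (by positivity)
    linarith

variable [MeasurableSpace X] [BorelSpace X]

lemma measure_preimage_smul {μ : Measure X} (hμ : InvProb (DihedralGroup 0) X μ)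
    (g : DihedralGroup 0) {A : Set X} (hA : MeasurableSet A) :
    μ ((fun x => g • x) ⁻¹' A) = μ A := by
  conv_rhs => rw [← hμ.2 g]
  rw [Measure.map_apply (continuous_const_smul g).measurable hA]

lemma NullClosed.preimage_smul {F : Set X} (h : NullClosed F) (g : DihedralGroup 0) :
    NullClosed ((fun x => g • x) ⁻¹' F) :=
  ⟨h.1.preimage (continuous_const_smul g), fun μ hμ => by
    rw [measure_preimage_smul hμ g h.1.measurableSet, h.2 μ hμ]⟩

lemma nullClosed_fixedPoints_ref [Infinite X] (hmin : Minimal (DihedralGroup 0) X) (a : ℤ) :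
    NullClosed {x : X | ref a • x = x} := by
  have hcl : ∀ a, IsClosed {x : X | ref a • x = x} := fun a =>
    isClosed_eq (continuous_const_smul _) continuous_id
  refine ⟨hcl a, fun μ hμ => ?_⟩
  have := hμ.1
  have hpre : ∀ j : ℕ, (fun x => rot j • x) ⁻¹' {x : X | ref a • x = x} =
      {x : X | ref (a + 2 * j) • x = x} := fun j => by
    ext x
    exact ref_smul_rot_smul_eq_iff a j x
  have hdisj : Pairwise (Function.onFun Disjoint fun j : ℕ => {x : X | ref (a + 2 * j) • x = x}) := by
    intro i j hij
    rw [Function.onFun, Set.disjoint_left]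
    intro x hx hx'
    have := eq_of_ref_smul_eq hmin hx hx'
    omega
  have hsum := measure_iUnion (μ := μ) hdisj fun j => (hcl _).measurableSet
  by_contra hne
  have hconst : ∀ j : ℕ, μ {x : X | ref (a + 2 * j) • x = x} = μ {x : X | ref a • x = x} :=
    fun j => by rw [← hpre, measure_preimage_smul hμ _ (hcl a).measurableSet]
  simp only [hconst, ENNReal.tsum_const_eq_top_of_ne_zero hne] at hsum
  exact measure_ne_top μ _ hsum

lemma exists_marker [CompactSpace X] [Infinite X] (hmin : Minimal (DihedralGroup 0) X)
    (hsbp : SBP (DihedralGroup 0) X) (L : ℕ) :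
    ∃ (Y : Set X) (P : ℕ), IsOpen Y ∧ NullClosed (frontier Y) ∧
      (fun x : X => ref 0 • x) ⁻¹' Y = Y ∧
      (∀ j : ℤ, 0 < j → j ≤ L → ∀ y ∈ Y, rot j • y ∉ Y) ∧
      ∀ x : X, ∃ p : ℕ, p < P ∧ rot p • x ∈ Y := by
  obtain ⟨x₀, hx₀⟩ := exists_forall_ref_smul_ne (X := X) hmin L
  have hev : ∀ᶠ U in (𝓝 x₀).smallSets, ∀ j ∈ Finset.Icc (-L : ℤ) L,
      Disjoint (ref j • U) U ∧ (j ≠ 0 → Disjoint (rot j • U) U) := by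
    refine (Finset.eventually_all _).2 fun j hj => ?_
    have hj' : |j| ≤ L := abs_le.2 (Finset.mem_Icc.1 hj)
    refine (eventually_disjoint_smul (hx₀ j hj')).and ?_
    by_cases h0 : j = 0
    · exact Eventually.of_forall fun U h => absurd h0 h
    · exact (eventually_disjoint_smul (rot_smul_ne hmin h0 x₀)).mono fun U h _ => h
  obtain ⟨s, hs, hsP⟩ := eventually_smallSets.1 hev
  obtain ⟨U, hUs, hU, hxU⟩ := mem_nhds_iff.1 hs
  obtain ⟨V, hV, hxV, hVU, hVnull⟩ := hsbp x₀ U hU hxU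
  have hVP := hsP V (hVU.trans hUs)
  have hVf : NullClosed (frontier V) := ⟨isClosed_frontier, hVnull⟩
  have hV' : IsOpen ((fun x : X => ref 0 • x) ⁻¹' V) := hV.preimage (continuous_const_smul _)
  have hYo := hV.union hV'
  have hinv : (fun x : X => ref 0 • x) ⁻¹' (V ∪ (fun x : X => ref 0 • x) ⁻¹' V) =
      V ∪ (fun x : X => ref 0 • x) ⁻¹' V := by
    ext x
    simp [ref_smul_ref, rot_zero_smul, or_comm]
  have hcov : ∀ x : X, ∃ k : ℤ, rot k • x ∈ V ∪ (fun x : X => ref 0 • x) ⁻¹' V := by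
    intro x
    obtain ⟨_, hyV, g, rfl⟩ := (hmin x).inter_open_nonempty V hV ⟨x₀, hxV⟩
    obtain ⟨k, rfl | rfl⟩ := exists_eq_rot_or_ref g
    · exact ⟨k, Or.inl hyV⟩
    · refine ⟨k, Or.inr ?_⟩
      simpa [ref_smul_rot] using hyV
  set Y := V ∪ (fun x : X => ref 0 • x) ⁻¹' V with hY
  obtain ⟨t, ht⟩ := isCompact_univ.elim_finite_subcover
    (fun k : ℤ => (fun x : X => rot k • x) ⁻¹' Y)
    (fun k => hYo.preimage (continuous_const_smul _))
    (fun x _ => Set.mem_iUnion.2 (hcov x))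
  obtain ⟨M, hM⟩ : ∃ M : ℕ, ∀ k ∈ t, |k| ≤ M :=
    ⟨t.sup Int.natAbs, fun k hk => by
      have := Finset.le_sup (f := Int.natAbs) hk
      rw [Int.abs_eq_natAbs]
      exact_mod_cast this⟩
  refine ⟨Y, 2 * M + 1, hYo, ⟨isClosed_frontier, fun μ hμ => ?_⟩, hinv, ?_, fun x => ?_⟩
  · have hpre : frontier ((fun x : X => ref 0 • x) ⁻¹' V) =
        (fun x : X => ref 0 • x) ⁻¹' frontier V :=
      ((Homeomorph.smul (ref 0)).preimage_frontier V).symm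
    refine measure_mono_null (frontier_union_subset V _) ?_
    refine measure_union_null (measure_mono_null Set.inter_subset_left (hVnull μ hμ))
      (measure_mono_null Set.inter_subset_right ?_)
    rw [hpre]
    exact (hVf.preimage_smul _).2 μ hμ
  · intro j hj hjL y hy hy'
    have hmem : j ∈ Finset.Icc (-L : ℤ) L := Finset.mem_Icc.2 ⟨by omega, hjL⟩
    have hmem' : -j ∈ Finset.Icc (-L : ℤ) L := Finset.mem_Icc.2 ⟨by omega, by omega⟩
    have hdis : ∀ g : DihedralGroup 0, Disjoint (g • V) V → ∀ v ∈ V, g • v ∉ V :=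
      fun g hg v hv => Set.disjoint_left.1 hg (Set.smul_mem_smul_set hv)
    rcases hy with hy | hy <;> rcases hy' with hy' | hy'
    · exact hdis _ ((hVP j hmem).2 hj.ne') y hy hy'
    · refine hdis _ (hVP j hmem).1 y hy ?_
      simpa [ref_smul_rot] using hy'
    · refine hdis _ (hVP (-j) hmem').1 _ hy ?_
      simpa [ref_smul_ref] using hy'
    · refine hdis _ ((hVP (-j) hmem').2 (by omega)) _ hy ?_
      simpa [rot_smul_ref, ref_smul_rot] using hy'
  · obtain ⟨k, hk, hkx⟩ := Set.mem_iUnion₂.1 (ht (Set.mem_univ (rot (M : ℤ) • x)))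
    have := abs_le.1 (hM k hk)
    refine ⟨(k + M).toNat, by omega, ?_⟩
    have e : ((k + M).toNat : ℤ) = k + M := Int.toNat_of_nonneg (by omega)
    rw [e, ← rot_smul_rot]
    exact hkx

end Freeness

section Tower

/-- The shape `{s ^ i, t * s ^ i | 0 ≤ i < n}`. -/
def tower (n : ℕ) : Finset (DihedralGroup 0) :=
  (range n).image (fun i : ℕ => rot i) ∪ (range n).image (fun i : ℕ => ref i)

lemma mem_tower {n : ℕ} {g : DihedralGroup 0} :
    g ∈ tower n ↔ (∃ i : ℕ, i < n ∧ g = rot i) ∨ ∃ i : ℕ, i < n ∧ g = ref i := by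
  simp [tower, eq_comm]

lemma card_tower (n : ℕ) : (tower n).card = 2 * n := by
  rw [tower, Finset.card_union_of_disjoint, Finset.card_image_of_injective,
    Finset.card_image_of_injective, Finset.card_range, two_mul]
  · exact ref_injective.comp Nat.cast_injective
  · exact rot_injective.comp Nat.cast_injective
  · simp only [Finset.disjoint_left, Finset.mem_image]
    rintro _ ⟨i, -, rfl⟩ ⟨j, -, h⟩
    exact rot_ne_ref _ _ h.symm

lemma exists_forall_isFolner_tower (K : Finset (DihedralGroup 0)) {ε : ℝ} (hε : 0 < ε) :
    ∃ L : ℕ, ∀ n ≥ L, IsFolner K (tower n) ε := by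
  obtain ⟨A, hA⟩ : ∃ A : ℕ, ∀ k : ℤ, rot k ∈ K ∨ ref k ∈ K → |k| ≤ A := by
    let φ : DihedralGroup 0 → ℕ := fun g => match g with
      | .r k => Int.natAbs k
      | .sr k => Int.natAbs k
    refine ⟨K.sup φ, fun k hk => ?_⟩
    rw [Int.abs_eq_natAbs]
    rcases hk with hk | hk <;> exact_mod_cast Finset.le_sup (f := φ) hk
  obtain ⟨L, hL⟩ := exists_nat_gt (2 * A / ε)
  rw [div_lt_iff₀ hε] at hL
  refine ⟨L, fun n hn => ?_⟩
  let I : Finset ℤ := Finset.Ico (-A : ℤ) 0 ∪ Finset.Ico (n : ℤ) (n + A)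
  have hI : I.card ≤ 2 * A := by
    refine (Finset.card_union_le _ _).trans ?_
    simp only [Int.card_Ico]
    omega
  have hsub : ∀ g, (∃ k ∈ K, ∃ h ∈ tower n, k * h = g) → g ∉ tower n →
      g ∈ I.image rot ∪ I.image ref := by
    have hmemI : ∀ j : ℤ, -A ≤ j → j < n + A → ¬ (0 ≤ j ∧ j < n) → j ∈ I := by
      intro j h1 h2 h3
      simp only [I, Finset.mem_union, Finset.mem_Ico]
      omega
    have hrot : ∀ j : ℤ, -A ≤ j → j < n + A → rot j ∉ tower n →
        rot j ∈ I.image rot ∪ I.image ref := by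
      intro j h1 h2 h3
      refine Finset.mem_union_left _ (Finset.mem_image_of_mem _ (hmemI j h1 h2 fun h => h3 ?_))
      exact mem_tower.2 (Or.inl ⟨j.toNat, by omega, by rw [Int.toNat_of_nonneg h.1]⟩)
    have href : ∀ j : ℤ, -A ≤ j → j < n + A → ref j ∉ tower n →
        ref j ∈ I.image rot ∪ I.image ref := by
      intro j h1 h2 h3
      refine Finset.mem_union_right _ (Finset.mem_image_of_mem _ (hmemI j h1 h2 fun h => h3 ?_))
      exact mem_tower.2 (Or.inr ⟨j.toNat, by omega, by rw [Int.toNat_of_nonneg h.1]⟩)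
    rintro _ ⟨k, hk, h, hh, rfl⟩ hg
    obtain ⟨a, rfl | rfl⟩ := exists_eq_rot_or_ref k
    · have ha := abs_le.1 (hA a (Or.inl hk))
      rcases mem_tower.1 hh with ⟨i, hi, rfl⟩ | ⟨i, hi, rfl⟩
      · exact hrot _ (by omega) (by omega) hg
      · exact href _ (by omega) (by omega) hg
    · have ha := abs_le.1 (hA a (Or.inr hk))
      rcases mem_tower.1 hh with ⟨i, hi, rfl⟩ | ⟨i, hi, rfl⟩
      · exact href _ (by omega) (by omega) hg
      · exact hrot _ (by omega) (by omega) hg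
  have hcard : (I.image rot ∪ I.image ref).card ≤ 4 * A := by
    refine (Finset.card_union_le _ _).trans ?_
    have h1 := Finset.card_image_le (s := I) (f := rot)
    have h2 := Finset.card_image_le (s := I) (f := ref)
    omega
  unfold IsFolner
  rw [card_tower]
  refine lt_of_le_of_lt (b := ((4 * A : ℕ) : ℝ)) ?_ ?_
  · refine Nat.cast_le.2 (le_trans (Finset.card_le_card ?_) hcard)
    intro g hg
    obtain ⟨h1, h2⟩ := (@Finset.mem_sdiff _ (Classical.decEq _) _ _ _).1 hg
    exact hsub g ((@Finset.mem_mul _ (Classical.decEq _) _ _ _ _).1 h1) h2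
  · have : (L : ℝ) ≤ n := by exact_mod_cast hn
    push_cast
    nlinarith

end Tower

section Gap

variable {X : Type*} [TopologicalSpace X] [MulAction (DihedralGroup 0) X]

/-- The points following a visit to `Y` whose next `n` orbit points avoid `closure Y` and are
followed by another visit to `Y`. -/
def gapBase (Y : Set X) (n : ℕ) : Set X :=
  {x | rot (-1) • x ∈ Y ∧ (∀ i : ℕ, i < n → rot i • x ∉ closure Y) ∧ rot n • x ∈ Y}

lemma gapBase_unique {Y : Set X} {n n' i i' : ℕ} {b b' : X} (hb : b ∈ gapBase Y n)
    (hb' : b' ∈ gapBase Y n') (hi : i < n) (hi' : i' < n') (h : rot i • b = rot i' • b') :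
    n = n' ∧ i = i' ∧ b = b' := by
  have key : ∀ (n n' i i' : ℕ) (b b' : X), b ∈ gapBase Y n → b' ∈ gapBase Y n' → i' < n' →
      rot i • b = rot i' • b' → i' ≤ i := by
    intro n n' i i' b b' hb hb' hi' h
    by_contra! hlt
    have h1 := congrArg (fun z => rot (-1 - i) • z) h
    simp only [rot_smul_rot] at h1
    have e1 : (-1 - (i : ℤ) + i) = -1 := by ring
    have e2 : (-1 - (i : ℤ) + i') = ((i' - i - 1 : ℕ) : ℤ) := by omega
    rw [e1, e2] at h1
    exact hb'.2.1 _ (by omega) (subset_closure (h1 ▸ hb.1))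
  have hii : i = i' := le_antisymm (key _ _ _ _ _ _ hb' hb hi h.symm) (key _ _ _ _ _ _ hb hb' hi' h)
  subst hii
  have hbb : b = b' := smul_left_cancel _ h
  subst hbb
  refine ⟨?_, rfl, rfl⟩
  rcases lt_trichotomy n n' with hlt | heq | hlt
  · exact absurd (subset_closure hb.2.2) (hb'.2.1 n hlt)
  · exact heq
  · exact absurd (subset_closure hb'.2.2) (hb.2.1 n' hlt)

/-- The part of `gapBase Y n` lying in `V k`, made disjoint from the earlier `V l` and from their
images under the reflection `ref (n - 1)`, which preserves `gapBase Y n`. -/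
def piece {q : ℕ} (Y : Set X) (V : Fin q → Set X) (n : ℕ) (k : Fin q) : Set X :=
  {x | x ∈ gapBase Y n ∧ x ∈ V k ∧
    ∀ l < k, x ∉ closure (V l) ∧ ref (n - 1) • x ∉ closure (V l)}

variable [ContinuousConstSMul (DihedralGroup 0) X]

lemma isOpen_gapBase {Y : Set X} (hY : IsOpen Y) (n : ℕ) : IsOpen (gapBase Y n) := by
  refine (hY.preimage (continuous_const_smul _)).inter (IsOpen.inter ?_
    (hY.preimage (continuous_const_smul _)))
  have : {x : X | ∀ i : ℕ, i < n → rot i • x ∉ closure Y} =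
      ⋂ i ∈ range n, (fun x => rot (i : ℤ) • x) ⁻¹' (closure Y)ᶜ := by
    ext x
    simp
  change IsOpen {x : X | ∀ i : ℕ, i < n → rot i • x ∉ closure Y}
  rw [this]
  exact isOpen_biInter_finset fun i _ =>
    isClosed_closure.isOpen_compl.preimage (continuous_const_smul _)

lemma ref_smul_mem_gapBase {Y : Set X} (hY : (fun x : X => ref 0 • x) ⁻¹' Y = Y) {n : ℕ} {x : X}
    (hx : x ∈ gapBase Y n) : ref (n - 1) • x ∈ gapBase Y n := by
  have hcl : (fun x : X => ref 0 • x) ⁻¹' closure Y = closure Y := by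
    conv_rhs => rw [← hY]
    exact (Homeomorph.smul (ref 0)).preimage_closure Y
  have key : ∀ j : ℤ, rot j • ref (n - 1) • x = ref 0 • rot (n - 1 - j) • x := fun j => by
    rw [rot_smul_ref, ref_smul_rot, zero_add]
  have hY' : ∀ z : X, ref 0 • z ∈ Y ↔ z ∈ Y := fun z => by
    conv_rhs => rw [← hY]
    rfl
  have hcl' : ∀ z : X, ref 0 • z ∈ closure Y ↔ z ∈ closure Y := fun z => by
    conv_rhs => rw [← hcl]
    rfl
  refine ⟨?_, fun i hi => ?_, ?_⟩
  · rw [key, hY']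
    convert hx.2.2 using 3
    ring
  · rw [key, hcl']
    convert hx.2.1 (n - 1 - i) (by omega) using 4
    omega
  · rw [key, hY']
    convert hx.1 using 3
    ring

lemma isOpen_piece {q : ℕ} {Y : Set X} (hY : IsOpen Y) {V : Fin q → Set X}
    (hV : ∀ k, IsOpen (V k)) (n : ℕ) (k : Fin q) : IsOpen (piece Y V n k) := by
  refine (isOpen_gapBase hY n).inter ((hV k).inter ?_)
  have : {x : X | ∀ l < k, x ∉ closure (V l) ∧ ref (n - 1) • x ∉ closure (V l)} =
      ⋂ l ∈ Finset.Iio k, ((closure (V l))ᶜ ∩ (fun x => ref (n - 1) • x) ⁻¹' (closure (V l))ᶜ) := by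
    ext x
    simp
  change IsOpen {x : X | ∀ l < k, x ∉ closure (V l) ∧ ref (n - 1) • x ∉ closure (V l)}
  rw [this]
  exact isOpen_biInter_finset fun i _ => isClosed_closure.isOpen_compl.inter
    (isClosed_closure.isOpen_compl.preimage (continuous_const_smul _))

lemma piece_level_unique {q : ℕ} {Y : Set X} (hY : (fun x : X => ref 0 • x) ⁻¹' Y = Y)
    {V : Fin q → Set X} {n n' : ℕ} (hV : ∀ k, ∀ x ∈ V k, ref (n - 1) • x ∉ V k)
    {k k' : Fin q} {g g' : DihedralGroup 0} {d d' : X}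
    (hd : d ∈ piece Y V n k) (hd' : d' ∈ piece Y V n' k') (hg : g ∈ tower n) (hg' : g' ∈ tower n')
    (h : g • d = g' • d') : n = n' ∧ k = k' ∧ g = g' := by
  have hform : ∀ {n : ℕ} {k : Fin q} {g : DihedralGroup 0} {d : X}, d ∈ piece Y V n k →
      g ∈ tower n → ∃ i : ℕ, i < n ∧
        ((g = rot i ∧ g • d = rot i • d) ∨
          (g = ref (n - 1 - i) ∧ g • d = rot i • ref (n - 1) • d)) := by
    intro n k g d hd hg
    rcases mem_tower.1 hg with ⟨i, hi, rfl⟩ | ⟨i, hi, rfl⟩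
    · exact ⟨i, hi, Or.inl ⟨rfl, rfl⟩⟩
    · refine ⟨n - 1 - i, by omega, Or.inr ⟨?_, ?_⟩⟩
      · congr 1; omega
      · rw [rot_smul_ref]; congr 2; omega
  have hcl : ∀ {k : Fin q} {x : X}, x ∈ V k → x ∈ closure (V k) := fun h => subset_closure h
  have hsame : ∀ k k' : Fin q, ∀ d : X, d ∈ piece Y V n k → d ∈ piece Y V n k' → k = k' := by
    intro k k' d h1 h2
    rcases lt_trichotomy k k' with hlt | heq | hlt
    · exact absurd (hcl h1.2.1) (h2.2.2 k hlt).1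
    · exact heq
    · exact absurd (hcl h2.2.1) (h1.2.2 k' hlt).1
  have hcross : ∀ k k' : Fin q, ∀ d : X, d ∈ piece Y V n k → ref (n - 1) • d ∈ piece Y V n k' →
      False := by
    intro k k' d h1 h2
    rcases lt_trichotomy k k' with hlt | heq | hlt
    · refine (h2.2.2 k hlt).2 ?_
      rw [ref_smul_ref_self]
      exact hcl h1.2.1
    · subst heq
      exact hV k d h1.2.1 h2.2.1
    · exact (h1.2.2 k' hlt).2 (hcl h2.2.1)
  obtain ⟨i, hi, hi2⟩ := hform hd hg
  obtain ⟨i', hi', hi2'⟩ := hform hd' hg'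
  rcases hi2 with ⟨rfl, e⟩ | ⟨rfl, e⟩ <;> rcases hi2' with ⟨rfl, e'⟩ | ⟨rfl, e'⟩ <;>
    rw [e, e'] at h
  · obtain ⟨rfl, rfl, rfl⟩ := gapBase_unique hd.1 hd'.1 hi hi' h
    exact ⟨rfl, hsame _ _ _ hd hd', rfl⟩
  · obtain ⟨rfl, rfl, rfl⟩ := gapBase_unique hd.1 (ref_smul_mem_gapBase hY hd'.1) hi hi' h
    exact (hcross _ _ _ hd' hd).elim
  · obtain ⟨rfl, rfl, hb⟩ := gapBase_unique (ref_smul_mem_gapBase hY hd.1) hd'.1 hi hi' h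
    exact (hcross _ _ _ hd (hb ▸ hd')).elim
  · obtain ⟨rfl, rfl, hb⟩ := gapBase_unique (ref_smul_mem_gapBase hY hd.1)
      (ref_smul_mem_gapBase hY hd'.1) hi hi' h
    have hdd : d = d' := smul_left_cancel _ hb
    subst hdd
    exact ⟨rfl, hsame _ _ _ hd hd', rfl⟩

lemma exists_mem_piece {q : ℕ} {Y : Set X} (hY : (fun x : X => ref 0 • x) ⁻¹' Y = Y)
    {V : Fin q → Set X} {n : ℕ} {x : X} (hx : x ∈ gapBase Y n) (hcov : ∃ k, x ∈ V k)
    (hf : ∀ k, x ∉ frontier (V k)) (hf' : ∀ k, ref (n - 1) • x ∉ frontier (V k)) :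
    ∃ k, x ∈ piece Y V n k ∨ ref (n - 1) • x ∈ piece Y V n k := by
  classical
  have hmem : ∀ (k : Fin q) (z : X), z ∈ closure (V k) → z ∉ frontier (V k) → z ∈ V k := by
    intro k z h1 h2
    by_contra h3
    exact h2 ⟨h1, fun h => h3 (interior_subset h)⟩
  have hex : ∃ m : ℕ, ∃ k : Fin q, (k : ℕ) = m ∧ (x ∈ V k ∨ ref (n - 1) • x ∈ V k) := by
    obtain ⟨k, hk⟩ := hcov
    exact ⟨k, k, rfl, Or.inl hk⟩
  obtain ⟨k, hk, hkx⟩ := Nat.find_spec hex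
  have hmin : ∀ l < k, x ∉ closure (V l) ∧ ref (n - 1) • x ∉ closure (V l) := by
    intro l hl
    have hl' : (l : ℕ) < Nat.find hex := hk ▸ hl
    have hnot := Nat.find_min hex hl'
    push Not at hnot
    obtain ⟨h1, h2⟩ := hnot l rfl
    exact ⟨fun h => h1 (hmem l _ h (hf l)), fun h => h2 (hmem l _ h (hf' l))⟩
  rcases hkx with h | h
  · exact ⟨k, Or.inl ⟨hx, h, hmin⟩⟩
  · refine ⟨k, Or.inr ⟨ref_smul_mem_gapBase hY hx, h, fun l hl => ?_⟩⟩
    rw [ref_smul_ref_self]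
    exact (hmin l hl).symm

end Gap

section Comparison

variable {X : Type*} [MulAction (DihedralGroup 0) X]

lemma visits_mono {U U' : Set X} (h : U ⊆ U') (N : ℕ) (x : X) : visits U N x ≤ visits U' N x :=
  Finset.sum_le_sum fun _ _ => Set.indicator_le_indicator_of_subset h (fun _ => zero_le_one) _

lemma visits_le_add (U U' : Set X) (N : ℕ) (x : X) :
    visits U N x ≤ visits (U \ U') N x + visits U' N x := by
  unfold visits
  rw [← Finset.sum_add_distrib]
  refine Finset.sum_le_sum fun p _ => ?_
  by_cases h : rot p • x ∈ U <;> by_cases h' : rot p • x ∈ U' <;> simp [h, h']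

lemma le_visits_mul {Y : Set X} {P : ℕ} (hP : ∀ x : X, ∃ p : ℕ, p < P ∧ rot p • x ∈ Y) (M : ℕ)
    (x : X) : (M : ℝ) ≤ visits Y (P * M) x := by
  induction M with
  | zero => simp [visits]
  | succ M ih =>
    have hsplit : visits Y (P * (M + 1)) x =
        visits Y (P * M) x + visits Y P (rot ((P * M : ℕ) : ℤ) • x) := by
      unfold visits
      rw [mul_add, mul_one, Finset.sum_range_add]
      congr 1
      refine Finset.sum_congr rfl fun p _ => ?_
      rw [rot_smul_rot]
      congr 3
      push_cast
      ring
    obtain ⟨p, hp, hpY⟩ := hP (rot ((P * M : ℕ) : ℤ) • x)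
    have hone : (1 : ℝ) ≤ visits Y P (rot ((P * M : ℕ) : ℤ) • x) := by
      have := Finset.single_le_sum (s := range P)
        (f := fun p : ℕ => Y.indicator (fun _ => (1 : ℝ)) (rot p • rot ((P * M : ℕ) : ℤ) • x))
        (fun i _ => Set.indicator_nonneg (fun _ _ => zero_le_one) _) (Finset.mem_range.2 hp)
      rwa [Set.indicator_of_mem hpY] at this
    rw [hsplit, Nat.cast_add, Nat.cast_one]
    linarith

lemma visits_sub_le_visits_smul (Y : Set X) (N : ℕ) (a : ℤ) (x : X) :
    visits Y N x - 2 * |(a : ℝ)| ≤ visits Y N (rot a • x) := by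
  have h := abs_sum_shift_sub_le (fun p => Y.indicator (fun _ => (1 : ℝ)) (rot p • x)) 1
    (fun p => by by_cases h : rot p • x ∈ Y <;> simp [h]) N a
  have h' := (abs_le.1 h).1
  simp only [visits, rot_smul_rot]
  push_cast at h'
  linarith

lemma visits_preimage_rot (U : Set X) (N : ℕ) (a : ℤ) (x : X) :
    visits ((fun z => rot a • z) ⁻¹' U) N x = visits U N (rot a • x) := by
  refine Finset.sum_congr rfl fun p _ => ?_
  have h : rot a • rot (p : ℤ) • x = rot (p : ℤ) • rot a • x := by
    rw [rot_smul_rot, rot_smul_rot, add_comm]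
  rw [← h]
  rfl

variable [MetricSpace X] [CompactSpace X] [ContinuousConstSMul (DihedralGroup 0) X]

/-- Visits to `Y` are separated and have bounded gaps, `E` is sparse, every point of `R` is in `Y`
or was in `E` recently, and `O` contains the four points following a visit to `Y \ E`.
Then `R ≺ O`. -/
lemma subord_of_marker {Y E R O : Set X} {P : ℕ} {η : ℝ} (hY : IsOpen Y) (hE : IsOpen E)
    (hR : IsClosed R) (hO : IsOpen O)
    (hsep : ∀ j : ℤ, 0 < j → j ≤ 4 → ∀ y ∈ Y, rot j • y ∉ Y)
    (hPpos : 0 < P)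
    (hP : ∀ x : X, ∃ p : ℕ, p < P ∧ rot p • x ∈ Y) (hη : (P + 3) * η * P ≤ 1 / 2)
    (hsparse : Sparse E η) (hYE : frontier Y ⊆ E)
    (hRYE : ∀ z ∈ R, z ∈ Y ∨ ∃ p : ℕ, p ≤ P ∧ rot (-p) • z ∈ E)
    (hYO : ∀ y ∈ Y \ E, ∀ i : ℕ, i < 4 → rot (i + 1) • y ∈ O) :
    Subord (DihedralGroup 0) X R O := by
  obtain ⟨N₀, hN₀⟩ := hsparse
  have hcl : closure Y \ E = Y \ E := by
    ext z
    refine ⟨fun h => ⟨?_, h.2⟩, fun h => ⟨subset_closure h.1, h.2⟩⟩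
    by_contra hz
    exact h.2 (hYE ⟨h.1, fun h => hz (interior_subset h)⟩)
  have hYEc : IsClosed (Y \ E) := hcl ▸ isClosed_closure.sdiff hE
  let D : Set X := Y ∪ ⋃ p : Fin (P + 1), (fun z => rot (-(p : ℕ)) • z) ⁻¹' E
  have hD : IsOpen D := hY.union
    (isOpen_iUnion fun p => hE.preimage (continuous_const_smul _))
  have hRD : R ⊆ D := fun z hz => by
    rcases hRYE z hz with h | ⟨p, hp, h⟩
    · exact Or.inl h
    · exact Or.inr (Set.mem_iUnion.2 ⟨⟨p, by omega⟩, h⟩)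
  obtain ⟨a, ha0, ha1, ha⟩ := exists_continuous_zero_one_of_isClosed hD.isClosed_compl hR
    (Set.disjoint_compl_left_iff_subset.2 hRD)
  let K : Set X := ⋃ i : Fin 4, (fun z => rot (-((i : ℕ) + 1)) • z) ⁻¹' (Y \ E)
  have hK : IsClosed K := isClosed_iUnion_of_finite fun i =>
    hYEc.preimage (continuous_const_smul _)
  have hKO : K ⊆ O := fun z hz => by
    obtain ⟨i, hi⟩ := Set.mem_iUnion.1 hz
    have := hYO _ hi i i.2
    rwa [rot_smul_rot, add_neg_cancel, rot_zero_smul] at this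
  obtain ⟨o, ho0, ho1, ho⟩ := exists_continuous_zero_one_of_isClosed hO.isClosed_compl hK
    (Set.disjoint_compl_left_iff_subset.2 hKO)
  have hale : ∀ z, a z ≤ Y.indicator (fun _ => (1 : ℝ)) z +
      ∑ j ∈ range (P + 1), E.indicator (fun _ => (1 : ℝ)) (rot (-(j : ℤ)) • z) := by
    intro z
    have hnn : 0 ≤ ∑ j ∈ range (P + 1), E.indicator (fun _ => (1 : ℝ)) (rot (-(j : ℤ)) • z) :=
      Finset.sum_nonneg fun j _ => Set.indicator_nonneg (fun _ _ => zero_le_one) _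
    by_cases hz : z ∈ D
    · rcases hz with hz | hz
      · rw [Set.indicator_of_mem hz]
        linarith [(ha z).2]
      · obtain ⟨p, hp⟩ := Set.mem_iUnion.1 hz
        have h1 := Finset.single_le_sum (s := range (P + 1))
          (f := fun j : ℕ => E.indicator (fun _ => (1 : ℝ)) (rot (-(j : ℤ)) • z))
          (fun i _ => Set.indicator_nonneg (fun _ _ => zero_le_one) _) (Finset.mem_range.2 p.2)
        have h2 : E.indicator (fun _ => (1 : ℝ)) (rot (-((p : ℕ) : ℤ)) • z) = 1 :=
          Set.indicator_of_mem (s := E) hp _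
        have h3 : 0 ≤ Y.indicator (fun _ => (1 : ℝ)) z :=
          Set.indicator_nonneg (fun _ _ => zero_le_one) _
        linarith [(ha z).2]
    · rw [show a z = 0 from ha0 hz]
      exact add_nonneg (Set.indicator_nonneg (fun _ _ => zero_le_one) _) hnn
  have hole : ∀ z, ∑ i ∈ range 4,
      (Y \ E).indicator (fun _ => (1 : ℝ)) (rot (-((i : ℤ) + 1)) • z) ≤ o z := by
    intro z
    by_cases hz : z ∈ K
    · obtain ⟨i, hi⟩ := Set.mem_iUnion.1 hz
      rw [show o z = 1 from ho1 hz, Finset.sum_eq_single (i : ℕ)]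
      · exact Set.indicator_le_self' (fun _ _ => zero_le_one) _
      · intro j hj hji
        have hj' := Finset.mem_range.1 hj
        have hi' := i.2
        refine Set.indicator_of_notMem (fun hjY => ?_) _
        rcases lt_or_gt_of_ne hji with hlt | hlt
        · refine hsep ((i : ℕ) - j) (by omega) (by omega) _ hi.1 ?_
          rw [rot_smul_rot]
          convert hjY.1 using 3
          ring
        · refine hsep (j - (i : ℕ)) (by omega) (by omega) _ hjY.1 ?_
          rw [rot_smul_rot]
          convert hi.1 using 3
          ring
      · exact fun h => absurd (Finset.mem_range.2 i.2) h
    · refine le_of_eq_of_le (Finset.sum_eq_zero fun i hi => ?_) (ho z).1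
      refine Set.indicator_of_notMem (fun h => hz ?_) _
      exact Set.mem_iUnion.2 ⟨⟨i, Finset.mem_range.1 hi⟩, h⟩
  have hcomm : ∀ (U : Set X) (s : Finset ℕ) (c : ℕ → ℤ) (N : ℕ) (x : X),
      ∑ p ∈ range N, ∑ j ∈ s, U.indicator (fun _ => (1 : ℝ)) (rot (c j) • rot p • x) =
        ∑ j ∈ s, visits U N (rot (c j) • x) := by
    intro U s c N x
    rw [Finset.sum_comm]
    simp only [visits, rot_smul_rot, add_comm]
  let M : ℕ := N₀ + 41
  have hNM : N₀ ≤ P * M := le_trans (by omega) (Nat.le_mul_of_pos_left M hPpos)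
  refine subord_of_sum_lt hR a ((1 / 2 : ℝ) • o) (fun x => (ha x).1) (fun x hx => ha1 hx)
    (fun x => ?_) (fun x => ?_) (fun x hx => ?_) (P * M) fun x => ?_
  · have := (ho x).1
    simp only [ContinuousMap.coe_smul, Pi.smul_apply, smul_eq_mul]
    linarith
  · have := (ho x).2
    simp only [ContinuousMap.coe_smul, Pi.smul_apply, smul_eq_mul]
    linarith
  · by_contra hxO
    exact hx (by simp [show o x = 0 from ho0 hxO])
  · have h1 : ∑ p ∈ range (P * M), a (rot p • x) ≤
        visits Y (P * M) x + (P + 1) * (η * (P * M : ℕ)) := by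
      refine (Finset.sum_le_sum fun (p : ℕ) _ => hale (rot (p : ℤ) • x)).trans ?_
      rw [Finset.sum_add_distrib, hcomm E _ (fun j => -(j : ℤ))]
      refine add_le_add le_rfl ((Finset.sum_le_sum fun j _ => hN₀ _ hNM _).trans ?_)
      rw [Finset.sum_const, Finset.card_range, nsmul_eq_mul]
      push_cast
      rfl
    have h2 : 4 * (visits Y (P * M) x - 8 - η * (P * M : ℕ)) ≤
        ∑ p ∈ range (P * M), o (rot p • x) := by
      refine le_trans ?_ (Finset.sum_le_sum fun (p : ℕ) _ => hole (rot (p : ℤ) • x))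
      rw [hcomm (Y \ E) _ (fun j => -((j : ℤ) + 1))]
      have h3 : ∀ j ∈ range 4, visits Y (P * M) x - 8 - η * (P * M : ℕ) ≤
          visits (Y \ E) (P * M) (rot (-((j : ℤ) + 1)) • x) := by
        intro j hj
        have h4 := visits_sub_le_visits_smul Y (P * M) (-((j : ℤ) + 1)) x
        have h5 := visits_le_add Y E (P * M) (rot (-((j : ℤ) + 1)) • x)
        have h6 := hN₀ _ hNM (rot (-((j : ℤ) + 1)) • x)
        have h7 : |((-((j : ℤ) + 1) : ℤ) : ℝ)| ≤ 4 := by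
          have : (j : ℝ) ≤ 3 := by
            have := Finset.mem_range.1 hj
            exact_mod_cast (by omega : j ≤ 3)
          have hj0 : (0 : ℝ) ≤ j := Nat.cast_nonneg j
          push_cast
          rw [abs_le]
          constructor <;> linarith
        linarith
      have h8 := Finset.card_nsmul_le_sum _ _ _ h3
      rw [Finset.card_range, nsmul_eq_mul] at h8
      exact_mod_cast h8
    have h9 := le_visits_mul hP M x
    have h10 : (P + 3) * η * P * M ≤ 1 / 2 * (M : ℝ) :=
      mul_le_mul_of_nonneg_right hη (Nat.cast_nonneg _)
    have h11 : (41 : ℝ) ≤ M := by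
      simp only [M]
      push_cast
      linarith [(Nat.cast_nonneg N₀ : (0 : ℝ) ≤ N₀)]
    simp only [ContinuousMap.coe_smul, Pi.smul_apply, smul_eq_mul, ← Finset.mul_sum]
    push_cast at h1 h2
    nlinarith
end Comparison

section Assembly

/-- The `8` group elements of `tower n` (for `8 ≤ n`) closest to the ends of a gap. -/
def ends (n : ℕ) : Finset (DihedralGroup 0) :=
  (range 4).image (fun i : ℕ => rot i) ∪ (range 4).image (fun i : ℕ => ref (n - 1 - i))

lemma card_ends_le (n : ℕ) : (ends n).card ≤ 8 :=
  (Finset.card_union_le _ _).trans (Nat.add_le_add Finset.card_image_le Finset.card_image_le)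

lemma ends_subset_tower {n : ℕ} (hn : 4 ≤ n) : ends n ⊆ tower n := by
  intro g hg
  simp only [ends, Finset.mem_union, Finset.mem_image, Finset.mem_range] at hg
  rcases hg with ⟨i, hi, rfl⟩ | ⟨i, hi, rfl⟩
  · exact mem_tower.2 (Or.inl ⟨i, by omega, rfl⟩)
  · refine mem_tower.2 (Or.inr ⟨n - 1 - i, by omega, ?_⟩)
    congr 1
    omega

variable {X : Type*} [TopologicalSpace X] [MulAction (DihedralGroup 0) X]

lemma exists_mem_smul_piece {q : ℕ} {Y : Set X} {V : Fin q → Set X} {n : ℕ} {x : X}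
    (hx : ∃ k, x ∈ piece Y V n k ∨ ref (n - 1) • x ∈ piece Y V n k) {j : ℕ} (hj : j < n) :
    ∃ k, ∃ g ∈ tower n, (j < 4 → g ∈ ends n) ∧ rot j • x ∈ g • piece Y V n k := by
  obtain ⟨k, hk | hk⟩ := hx
  · refine ⟨k, rot j, mem_tower.2 (Or.inl ⟨j, hj, rfl⟩), fun hj4 => ?_, Set.smul_mem_smul_set hk⟩
    exact Finset.mem_union_left _ (Finset.mem_image.2 ⟨j, Finset.mem_range.2 hj4, rfl⟩)
  · refine ⟨k, ref (n - 1 - j), mem_tower.2 (Or.inr ⟨n - 1 - j, by omega, ?_⟩), fun hj4 => ?_, ?_⟩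
    · congr 1
      omega
    · exact Finset.mem_union_right _ (Finset.mem_image.2 ⟨j, Finset.mem_range.2 hj4, rfl⟩)
    · refine ⟨_, hk, ?_⟩
      dsimp only
      rw [ref_smul_ref]
      congr 2
      ring

lemma exists_mem_gapBase {Y : Set X} {L P : ℕ}
    (hsep : ∀ j : ℤ, 0 < j → j ≤ L → ∀ y ∈ Y, rot j • y ∉ Y)
    (hP : ∀ x : X, ∃ p : ℕ, p < P ∧ rot p • x ∈ Y) {y : X} (hy : y ∈ Y)
    (hfr : ∀ j : ℕ, j ≤ L + P → rot j • y ∉ frontier Y) :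
    ∃ n : ℕ, L ≤ n ∧ n < L + P ∧ rot 1 • y ∈ gapBase Y n ∧
      rot ((n : ℤ) + 1) • y ∈ Y := by
  classical
  have hex : ∃ r : ℕ, 0 < r ∧ r ≤ L + P ∧ rot r • y ∈ Y := by
    obtain ⟨p, hp, hpY⟩ := hP (rot ((L + 1 : ℕ) : ℤ) • y)
    refine ⟨p + (L + 1), by omega, by omega, ?_⟩
    rwa [rot_smul_rot] at hpY
  obtain ⟨hr0, hrP, hrY⟩ := Nat.find_spec hex
  have hmin := fun m (hm : m < Nat.find hex) => Nat.find_min hex hm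
  generalize Nat.find hex = r at hr0 hrP hrY hmin
  obtain ⟨n, rfl⟩ : ∃ n, r = n + 1 := ⟨r - 1, by omega⟩
  have hL : L ≤ n := by
    by_contra h
    exact hsep _ (by omega) (by omega) y hy hrY
  refine ⟨n, hL, by omega, ⟨?_, fun i hi hcl => ?_, ?_⟩, by exact_mod_cast hrY⟩
  · rwa [rot_smul_rot, neg_add_cancel, rot_zero_smul]
  · have e : rot i • rot 1 • y = rot ((i + 1 : ℕ) : ℤ) • y := by
      rw [rot_smul_rot]
      push_cast
      rfl
    rw [e] at hcl
    refine hmin (i + 1) (by omega) ⟨by omega, by omega, ?_⟩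
    by_contra h
    exact hfr (i + 1) (by omega) ⟨hcl, fun h' => h (interior_subset h')⟩
  · rw [rot_smul_rot]
    exact_mod_cast hrY

end Assembly

section Cover

variable {X : Type*} [MetricSpace X] [CompactSpace X] [MulAction (DihedralGroup 0) X]
  [ContinuousConstSMul (DihedralGroup 0) X] [MeasurableSpace X]

lemma exists_finite_cover (hsbp : SBP (DihedralGroup 0) X) (A T : Finset (DihedralGroup 0))
    {W : Set X} (hW : IsOpen W) (hfix : ∀ a ∈ A, ∀ x, a • x = x → x ∈ W) {ε : ℝ} (hε : 0 < ε) :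
    ∃ (q : ℕ) (V : Fin q → Set X), (∀ k, IsOpen (V k)) ∧ (∀ k, NullClosed (frontier (V k))) ∧
      (∀ k, ∀ a ∈ A, Disjoint (a • V k) (V k)) ∧ (∀ k, ∀ g ∈ T, Metric.diam (g • V k) < ε) ∧
      ∀ x ∉ W, ∃ k, x ∈ V k := by
  have hloc : ∀ x : X, x ∉ W → ∃ V : Set X, IsOpen V ∧ x ∈ V ∧ NullClosed (frontier V) ∧
      (∀ a ∈ A, Disjoint (a • V) V) ∧ ∀ g ∈ T, Metric.diam (g • V) < ε := by
    intro x hx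
    have h1 : ∀ᶠ U in (𝓝 x).smallSets, ∀ a ∈ A, Disjoint (a • U) U :=
      (Filter.eventually_all_finset A).2 fun a ha =>
        eventually_disjoint_smul fun h => hx (hfix a ha x h)
    have h2 : ∀ᶠ U in (𝓝 x).smallSets, ∀ g ∈ T, Metric.diam (g • U) < ε :=
      (Filter.eventually_all_finset T).2 fun g _ => eventually_diam_smul_lt g x hε
    obtain ⟨U, hU, hU'⟩ := eventually_smallSets.1 (h1.and h2)
    obtain ⟨V, hV, hxV, hVU, hnull⟩ := hsbp x (interior U) isOpen_interior
      (mem_interior_iff_mem_nhds.2 hU)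
    have := hU' V (hVU.trans interior_subset)
    exact ⟨V, hV, hxV, ⟨isClosed_frontier, hnull⟩, this.1, this.2⟩
  choose! V hV hxV hnull hdisj hdiam using hloc
  obtain ⟨t, ht, hcov⟩ := hW.isClosed_compl.isCompact.elim_nhds_subcover V
    fun x hx => (hV x hx).mem_nhds (hxV x hx)
  let e := t.equivFin.symm
  refine ⟨t.card, fun k => V (e k), fun k => hV _ (ht _ (e k).2), fun k => hnull _ (ht _ (e k).2),
    fun k => hdisj _ (ht _ (e k).2), fun k => hdiam _ (ht _ (e k).2), fun x hx => ?_⟩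
  obtain ⟨y, hy, hxy⟩ := Set.mem_iUnion₂.1 (hcov hx)
  refine ⟨e.symm ⟨y, hy⟩, ?_⟩
  change x ∈ V (e (e.symm ⟨y, hy⟩))
  rwa [Equiv.apply_symm_apply]

variable [BorelSpace X]

lemma NullClosed.exists_sparse {F : Set X} (h : NullClosed F) {η : ℝ} (hη : 0 < η) :
    ∃ U, IsOpen U ∧ F ⊆ U ∧ Sparse U η :=
  exists_isOpen_sparse h.1 h.2 hη

/-- A sparse open set containing all the points `y` for which the return data of `y` to `Y` up to
time `Q` meet the boundaries, or for which `rot 1 • y` is in the sparse set `W`. -/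
lemma exists_sparse_exceptional {Y W : Set X} {q : ℕ} {V : Fin q → Set X} {η : ℝ} (hη : 0 < η)
    (hY : NullClosed (frontier Y)) (hV : ∀ k, NullClosed (frontier (V k))) (hW : IsOpen W)
    (hWs : Sparse W (η / 2)) (Q : ℕ) :
    ∃ E : Set X, IsOpen E ∧ Sparse E η ∧ ∀ y ∉ E, rot 1 • y ∉ W ∧
      (∀ j : ℕ, j ≤ Q → rot j • y ∉ frontier Y) ∧
      ∀ k, rot 1 • y ∉ frontier (V k) ∧
        ∀ n : ℕ, n < Q → ref ((n : ℤ) - 1) • rot 1 • y ∉ frontier (V k) := by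
  let F : Set X := (⋃ j : Fin (Q + 1), (fun z => rot (j : ℕ) • z) ⁻¹' frontier Y) ∪
    ⋃ k, ((fun z => rot 1 • z) ⁻¹' frontier (V k) ∪
      ⋃ n : Fin Q, (fun z => ref (((n : ℕ) : ℤ) - 1 + 1) • z) ⁻¹' frontier (V k))
  have hF : NullClosed F := (nullClosed_iUnion fun _ => hY.preimage_smul _).union
    (nullClosed_iUnion fun k => ((hV k).preimage_smul _).union
      (nullClosed_iUnion fun _ => (hV k).preimage_smul _))
  obtain ⟨U, hU, hFU, N₁, hN₁⟩ := hF.exists_sparse (half_pos hη)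
  obtain ⟨N₂, hN₂⟩ := hWs
  refine ⟨(fun z => rot 1 • z) ⁻¹' W ∪ U, (hW.preimage (continuous_const_smul _)).union hU,
    ⟨max N₁ N₂, fun N hN x => ?_⟩, fun y hy => ⟨fun h => hy (Or.inl h), fun j hj h => ?_,
      fun k => ⟨fun h => ?_, fun n hn h => ?_⟩⟩⟩
  · have h1 := hN₁ N (le_of_max_le_left hN) x
    have h2 := hN₂ N (le_of_max_le_right hN) (rot 1 • x)
    have h3 := visits_le_add ((fun z => rot 1 • z) ⁻¹' W ∪ U) U N x
    have h4 := visits_mono (U := ((fun z => rot 1 • z) ⁻¹' W ∪ U) \ U)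
      (U' := (fun z => rot 1 • z) ⁻¹' W) (by
        rintro z ⟨hz | hz, hz'⟩
        · exact hz
        · exact absurd hz hz') N x
    rw [visits_preimage_rot] at h4
    linarith
  · exact hy (Or.inr (hFU (Or.inl (Set.mem_iUnion.2 ⟨⟨j, by omega⟩, h⟩))))
  · exact hy (Or.inr (hFU (Or.inr (Set.mem_iUnion.2 ⟨k, Or.inl h⟩))))
  · refine hy (Or.inr (hFU (Or.inr (Set.mem_iUnion.2 ⟨k, Or.inr (Set.mem_iUnion.2 ⟨⟨n, hn⟩, ?_⟩)⟩))))
    rw [ref_smul_rot] at h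
    exact h

end Cover

end DihedralAction

open DihedralAction in
theorem almostFinite_of_minimal_dihedral_sbp
    (X : Type*) [MetricSpace X] [CompactSpace X] [Infinite X]
    [MeasurableSpace X] [BorelSpace X]
    [MulAction (DihedralGroup 0) X] [ContinuousConstSMul (DihedralGroup 0) X]
    (hmin : Minimal (DihedralGroup 0) X) (hsbp : SBP (DihedralGroup 0) X) :
    AlmostFinite (DihedralGroup 0) X := by
  intro K m hm ε hε
  obtain ⟨L₀, hL₀⟩ := exists_forall_isFolner_tower K hε
  let L : ℕ := max L₀ (4 * m + 1)
  have hLL₀ : L₀ ≤ L := le_max_left _ _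
  have hLm : 4 * m + 1 ≤ L := le_max_right _ _
  obtain ⟨Y, P, hY, hYnull, hYref, hsep, hP⟩ := exists_marker hmin hsbp L
  have hPpos : 0 < P := by
    obtain ⟨x⟩ : Nonempty X := inferInstance
    obtain ⟨p, hp, -⟩ := hP x
    omega
  have hPpos' : (0 : ℝ) < P := by exact_mod_cast hPpos
  let η : ℝ := 1 / (2 * P * (P + 3))
  have hη : 0 < η := by positivity
  -- A sparse neighbourhood of the fixed points of the reflections that flip the gaps.
  have hFix : NullClosed (⋃ n : Fin (L + P), {x : X | ref (((n : ℕ) : ℤ) - 1) • x = x}) :=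
    nullClosed_iUnion fun n => nullClosed_fixedPoints_ref hmin _
  obtain ⟨W, hW, hFW, hWs⟩ := hFix.exists_sparse (half_pos hη)
  obtain ⟨q, V, hV, hVnull, hVdisj, hVdiam, hVcov⟩ := exists_finite_cover hsbp
    ((Finset.range (L + P)).image fun n : ℕ => ref ((n : ℤ) - 1))
    ((Finset.range (L + P)).biUnion tower) hW (by
      simp only [Finset.mem_image, Finset.mem_range]
      rintro _ ⟨n, hn, rfl⟩ x hx
      exact hFW (Set.mem_iUnion.2 ⟨⟨n, hn⟩, hx⟩)) hε
  obtain ⟨E, hE, hEs, hEgood⟩ := exists_sparse_exceptional (Y := Y) hη hYnull hVnull hW hWs (L + P)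
  have hflip : ∀ n < L + P, ∀ k, ∀ x ∈ V k, ref ((n : ℤ) - 1) • x ∉ V k := by
    intro n hn k x hx hx'
    exact Set.disjoint_left.1 (hVdisj k _ (Finset.mem_image.2 ⟨n, Finset.mem_range.2 hn, rfl⟩))
      (Set.smul_mem_smul_set hx) hx'
  let c : Fin (P * q) ≃ Fin P × Fin q := finProdFinEquiv.symm
  let len : Fin (P * q) → ℕ := fun i => L + (c i).1
  have hlen : ∀ i, len i < L + P := fun i => Nat.add_lt_add_left (c i).1.2 L
  let B : Fin (P * q) → Set X := fun i => piece Y V (len i) (c i).2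
  have hopen : ∀ i, IsOpen (B i) := fun i => isOpen_piece hY hV _ _
  have hunion : ∀ (S : ℕ → Finset (DihedralGroup 0)),
      IsOpen (CastleUnion (DihedralGroup 0) X (fun i => S (len i)) B) := fun S =>
    isOpen_iUnion fun i => isOpen_biUnion fun s _ => (hopen i).smul s
  have hmemU : ∀ (S : ℕ → Finset (DihedralGroup 0)) (n : ℕ) (k : Fin q) (g : DihedralGroup 0)
      (x : X), L ≤ n → n < L + P → g ∈ S n → x ∈ g • piece Y V n k →
      x ∈ CastleUnion (DihedralGroup 0) X (fun i => S (len i)) B := by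
    intro S n k g x h1 h2 hg hx
    have hc : c (finProdFinEquiv (⟨n - L, by omega⟩, k)) = (⟨n - L, by omega⟩, k) :=
      Equiv.symm_apply_apply _ _
    have hl : len (finProdFinEquiv (⟨n - L, by omega⟩, k)) = n := by
      simp only [len, hc]
      omega
    refine Set.mem_iUnion.2 ⟨finProdFinEquiv (⟨n - L, by omega⟩, k), Set.mem_iUnion₂.2
      ⟨g, by simpa only [hl] using hg, ?_⟩⟩
    simp only [B, hl, hc]
    exact hx
  -- Every good visit to `Y` starts a gap that is covered by the castle.
  have hgap : ∀ y ∈ Y \ E, ∃ n : ℕ, L ≤ n ∧ n < L + P ∧ rot ((n : ℤ) + 1) • y ∈ Y ∧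
      ∃ k, rot 1 • y ∈ piece Y V n k ∨ ref ((n : ℤ) - 1) • rot 1 • y ∈ piece Y V n k := by
    intro y hy
    obtain ⟨hyW, hyY, hyV⟩ := hEgood y hy.2
    obtain ⟨n, h1, h2, h3, h4⟩ := exists_mem_gapBase hsep hP hy.1 hyY
    exact ⟨n, h1, h2, h4, exists_mem_piece hYref h3 (hVcov _ hyW) (fun k => (hyV k).1)
      fun k => (hyV k).2 n h2⟩
  refine ⟨P * q, fun i => tower (len i), B, ?_, hopen, fun i => hL₀ _ (by simp only [len]; omega),
    fun i s hs => ?_, fun i => ends (len i), fun i => ⟨ends_subset_tower (by simp only [len]; omega),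
      ?_⟩, ?_⟩
  · intro i j s hs t ht hne
    rw [Set.disjoint_left]
    rintro _ ⟨d, hd, rfl⟩ ⟨d', hd', h⟩
    obtain ⟨h1, h2, h3⟩ := piece_level_unique hYref (hflip _ (hlen i)) hd hd' hs ht h.symm
    have hij : c i = c j := Prod.ext (Fin.ext (by simpa only [len, Nat.add_left_cancel_iff] using h1)) h2
    exact hne (Prod.ext (c.injective hij) h3)
  · refine lt_of_le_of_lt (Metric.diam_mono (Set.smul_set_mono fun x hx => hx.2.1)
      (Metric.isBounded_of_compactSpace.subset (Set.subset_univ _))) (hVdiam (c i).2 s ?_)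
    exact Finset.mem_biUnion.2 ⟨len i, Finset.mem_range.2 (hlen i), hs⟩
  · rw [card_tower, lt_div_iff₀ (by exact_mod_cast hm)]
    have h1 : (ends (len i)).card * m ≤ 8 * m := Nat.mul_le_mul_right m (card_ends_le _)
    have h2 : 8 * m < 2 * len i := by
      simp only [len]
      omega
    exact_mod_cast h1.trans_lt h2
  · refine subord_of_marker (Y := Y) (E := E) (P := P) (η := η) hY hE ?_ (hunion ends)
      (fun j h1 h2 => hsep j h1 (by omega)) hPpos hP ?_ hEs ?_ ?_ ?_
    · exact isClosed_univ.sdiff (hunion tower)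
    · simp only [η]
      apply le_of_eq
      field_simp
    · intro z hz
      by_contra hzE
      have := (hEgood z hzE).2.1 0 (Nat.zero_le _)
      rw [Nat.cast_zero, rot_zero_smul] at this
      exact this hz
    · rintro z ⟨-, hz⟩
      by_contra! hcon
      obtain ⟨hzY, hzE⟩ := hcon
      have hex : ∃ p : ℕ, p ≤ P ∧ rot (-p) • z ∈ Y := by
        obtain ⟨p, hp, hpY⟩ := hP (rot (-(P : ℤ)) • z)
        refine ⟨P - p, by omega, ?_⟩
        rw [rot_smul_rot] at hpY
        convert hpY using 3
        omega
      classical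
      obtain ⟨hpP, hpY⟩ := Nat.find_spec hex
      have hpmin := fun r (hr : r < Nat.find hex) => Nat.find_min hex hr
      generalize Nat.find hex = p at hpP hpY hpmin
      have hp0 : p ≠ 0 := by
        rintro rfl
        rw [Nat.cast_zero, neg_zero, rot_zero_smul] at hpY
        exact hzY hpY
      obtain ⟨n, h1, h2, hret, hk⟩ := hgap _ ⟨hpY, hzE p hpP⟩
      have hpn : p ≤ n := by
        by_contra! hlt
        refine hpmin (p - (n + 1)) (by omega) ⟨by omega, ?_⟩
        rw [rot_smul_rot] at hret
        convert hret using 3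
        omega
      obtain ⟨k, g, hg, -, hzg⟩ := exists_mem_smul_piece hk (j := p - 1) (by omega)
      refine hz (hmemU tower n k g z h1 h2 hg ?_)
      convert hzg using 1
      rw [rot_smul_rot, rot_smul_rot]
      conv_lhs => rw [← rot_zero_smul z]
      congr 2
      omega
    · intro y hy i hi
      obtain ⟨n, h1, h2, -, hk⟩ := hgap y hy
      obtain ⟨k, g, -, hg, hzg⟩ := exists_mem_smul_piece hk (j := i) (by omega)
      rw [rot_smul_rot] at hzg
      exact hmemU ends n k g _ h1 h2 (hg hi) hzg
end

section
/- Let Γ be a countable amenable group, H ⊴ Γ a normal subgroup, G = Γ/H with quotient homomorphism ρ: Γ → G. Let Γ act continuously on a compact metrizable space X such that the orbit space Y = X/H is Hausdorff, with quotient map π: X → Y and induced G-action β on Y. Then the pushforward map π*: M_Γ(X) → M_G(Y), defined by (π*μ)(A) = μ(π⁻¹(A)) for Borel A ⊆ Y, is well defined (π*μ is a G-invariant Borel probability measure on Y) and surjective onto M_G(Y). -/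
open scoped Pointwise
open MeasureTheory

open Paper

open Filter Topology

/-- A positive linear functional on `C(X, ℝ)`, for `X` compact Hausdorff, is integration against
a finite Borel measure. -/
theorem exists_finiteMeasure_integral_eq {X : Type*} [TopologicalSpace X] [T2Space X]
    [CompactSpace X] [MeasurableSpace X] [BorelSpace X] (Λ : C(X, ℝ) →ₗ[ℝ] ℝ)
    (hΛ : ∀ f, 0 ≤ f → 0 ≤ Λ f) :
    ∃ μ : Measure X, IsFiniteMeasure μ ∧ ∀ f : C(X, ℝ), ∫ x, f x ∂μ = Λ f := by
  let L : CompactlySupportedContinuousMap X ℝ →ₚ[ℝ] ℝ :=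
    { toFun := fun f => Λ f.toContinuousMap
      map_add' := fun f g => Λ.map_add f.toContinuousMap g.toContinuousMap
      map_smul' := fun c f => Λ.map_smul c f.toContinuousMap
      monotone' := fun f g hfg => by
        have h := hΛ (g.toContinuousMap - f.toContinuousMap) (sub_nonneg.2 hfg)
        rw [map_sub] at h
        exact sub_nonneg.1 h }
  refine ⟨RealRMK.rieszMeasure L, inferInstance, fun f => ?_⟩
  exact RealRMK.integral_rieszMeasure L (CompactlySupportedContinuousMap.continuousMapEquiv f)

/-- A Borel probability measure on `Y` lifts, along a continuous surjection `π : X → Y` of compact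
spaces, to a positive linear functional on `C(X, ℝ)`. -/
theorem exists_positive_functional_lift {X Y : Type*} [TopologicalSpace X] [CompactSpace X]
    [TopologicalSpace Y] [CompactSpace Y] [MeasurableSpace Y] [BorelSpace Y]
    (π : C(X, Y)) (hπ : Function.Surjective π) (ν : Measure Y) [IsFiniteMeasure ν] :
    ∃ Λ : C(X, ℝ) →ₗ[ℝ] ℝ, (∀ f, 0 ≤ f → 0 ≤ Λ f) ∧
      ∀ g : C(Y, ℝ), Λ (g.comp π) = ∫ y, g y ∂ν := by
  let T : C(Y, ℝ) →ₗ[ℝ] C(X, ℝ) :=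
    { toFun := fun g => g.comp π
      map_add' := fun _ _ => rfl
      map_smul' := fun _ _ => rfl }
  have hT : Function.Injective T := fun g g' h => by
    ext y
    obtain ⟨x, rfl⟩ := hπ y
    exact DFunLike.congr_fun h x
  have integrable_cont : ∀ g : C(Y, ℝ), Integrable (fun y => g y) ν := fun g =>
    (BoundedContinuousFunction.mkOfCompact g).integrable ν
  let I : C(Y, ℝ) →ₗ[ℝ] ℝ :=
    { toFun := fun g => ∫ y, g y ∂ν
      map_add' := fun g g' => integral_add (integrable_cont g) (integrable_cont g')
      map_smul' := fun c g => integral_const_mul c _ }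
  let e := LinearEquiv.ofInjective T hT
  let F : C(X, ℝ) →ₗ.[ℝ] ℝ := ⟨LinearMap.range T, I ∘ₗ e.symm.toLinearMap⟩
  have hF : ∀ g, F (e g) = ∫ y, g y ∂ν := fun g => by
    change I (e.symm (e g)) = _
    rw [LinearEquiv.symm_apply_apply]
    rfl
  have hnonneg : ∀ x : F.domain, (x : C(X, ℝ)) ∈ PointedCone.positive ℝ C(X, ℝ) → 0 ≤ F x := by
    intro x hx
    obtain ⟨g, rfl⟩ := e.surjective x
    rw [hF]
    refine integral_nonneg fun y => ?_
    obtain ⟨x, rfl⟩ := hπ y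
    exact (show (0 : C(X, ℝ)) ≤ T g from hx) x
  have hdense : ∀ f : C(X, ℝ), ∃ x : F.domain,
      (x : C(X, ℝ)) + f ∈ PointedCone.positive ℝ C(X, ℝ) := by
    intro f
    refine ⟨e (ContinuousMap.const Y ‖f‖), ?_⟩
    change (0 : C(X, ℝ)) ≤ T _ + f
    intro x
    have h := (abs_le.1 (f.norm_coe_le_norm x)).1
    change 0 ≤ ‖f‖ + f x
    linarith
  obtain ⟨Λ, hΛF, hΛ⟩ := riesz_extension _ F hnonneg hdense
  exact ⟨Λ, fun f hf => hΛ f hf, fun g => (hΛF (e g)).trans (hF g)⟩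

/-- Averages of a bounded function over a Følner set are almost invariant. -/
theorem Paper.IsFolner.abs_average_sub_le {Γ : Type*} [Group Γ] {K S : Finset Γ} {ε : ℝ}
    (hS : IsFolner K S ε) {k : Γ} (hk : k ∈ K) {F : Γ → ℝ} {C : ℝ} (hF : ∀ s, |F s| ≤ C) :
    |(∑ s ∈ S, F (k * s)) / S.card - (∑ s ∈ S, F s) / S.card| ≤ 2 * C * ε := by
  classical
  have hC : 0 ≤ C := (abs_nonneg _).trans (hF 1)
  have hS' : (((K * S) \ S).card : ℝ) < ε * S.card := by
    unfold IsFolner at hS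
    convert hS
  have hpos : (0 : ℝ) < S.card := by
    rcases S.eq_empty_or_nonempty with rfl | h
    · simp at hS'
    · exact_mod_cast h.card_pos
  let T : Finset Γ := S.image (k * ·)
  have hT : T.card = S.card := Finset.card_image_of_injective _ (mul_right_injective k)
  have hsum : ∑ s ∈ S, F (k * s) = ∑ t ∈ T, F t :=
    (Finset.sum_image fun _ _ _ _ h => mul_right_injective k h).symm
  have hTS : ((T \ S).card : ℝ) ≤ ε * S.card := by
    refine le_trans ?_ hS'.le
    have hsub : T ⊆ K * S := fun t ht => by
      obtain ⟨s, hs, rfl⟩ := Finset.mem_image.1 ht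
      exact Finset.mul_mem_mul hk hs
    exact_mod_cast Finset.card_le_card (Finset.sdiff_subset_sdiff hsub le_rfl)
  have hST : ((S \ T).card : ℝ) ≤ ε * S.card := by
    rwa [Finset.card_sdiff_comm hT.symm]
  have hbd : ∀ A : Finset Γ, |∑ s ∈ A, F s| ≤ A.card * C := fun A => by
    refine (Finset.abs_sum_le_sum_abs _ _).trans ?_
    simpa using Finset.sum_le_card_nsmul A _ C fun s _ => hF s
  rw [hsum, ← sub_div, abs_div, abs_of_pos hpos, div_le_iff₀ hpos,
    ← Finset.sum_sdiff_sub_sum_sdiff]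
  calc |∑ s ∈ T \ S, F s - ∑ s ∈ S \ T, F s|
      ≤ |∑ s ∈ T \ S, F s| + |∑ s ∈ S \ T, F s| := abs_sub _ _
    _ ≤ (T \ S).card * C + (S \ T).card * C := add_le_add (hbd _) (hbd _)
    _ ≤ (ε * S.card) * C + (ε * S.card) * C := by gcongr
    _ = 2 * C * ε * S.card := by ring

/-- A Følner-amenable group has a left-invariant family of averages along an ultrafilter. -/
theorem Paper.FolnerAmenable.exists_ultrafilter {Γ : Type*} [Group Γ] (h : FolnerAmenable Γ) :
    ∃ (U : Ultrafilter (Finset Γ × ℕ)) (S : Finset Γ × ℕ → Finset Γ), (∀ i, (S i).Nonempty) ∧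
      ∀ (F : Γ → ℝ) (C : ℝ), (∀ s, |F s| ≤ C) → ∀ k : Γ,
        Tendsto (fun i => (∑ s ∈ S i, F (k * s)) / (S i).card - (∑ s ∈ S i, F s) / (S i).card)
          U (𝓝 0) := by
  classical
  choose S hS using fun i : Finset Γ × ℕ =>
    h i.1 (1 / ((i.2 : ℝ) + 1)) Nat.one_div_pos_of_nat
  refine ⟨Ultrafilter.of atTop, S, fun i => ?_, fun F C hF k => ?_⟩
  · by_contra hne
    have h0 := hS i
    rw [Finset.not_nonempty_iff_eq_empty] at hne
    simp [IsFolner, hne] at h0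
  · refine Tendsto.mono_left ?_ (Ultrafilter.of_le atTop)
    have hsnd : Tendsto (fun i : Finset Γ × ℕ => 2 * C * (1 / ((i.2 : ℝ) + 1))) atTop (𝓝 0) := by
      have h2 : Tendsto (Prod.snd : Finset Γ × ℕ → ℕ) atTop atTop := by
        rw [← prod_atTop_atTop_eq]
        exact tendsto_snd
      simpa using ((tendsto_one_div_add_atTop_nhds_zero_nat (𝕜 := ℝ)).comp h2).const_mul (2 * C)
    refine squeeze_zero_norm' ?_ hsnd
    filter_upwards [eventually_ge_atTop (({k} : Finset Γ), 0)] with i hi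
    exact (hS i).abs_average_sub_le (hi.1 (Finset.mem_singleton_self k)) hF

/-- Averaging a positive functional over an amenable group acting on a compact space. -/
theorem Paper.FolnerAmenable.exists_invariant_functional {Γ : Type*} [Group Γ] (h : FolnerAmenable Γ)
    {X : Type*} [TopologicalSpace X] [CompactSpace X] [MulAction Γ X] [ContinuousConstSMul Γ X]
    (Λ : C(X, ℝ) →ₗ[ℝ] ℝ) (hΛ : ∀ f, 0 ≤ f → 0 ≤ Λ f) :
    ∃ M : C(X, ℝ) →ₗ[ℝ] ℝ, (∀ f, 0 ≤ f → 0 ≤ M f) ∧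
      (∀ (k : Γ) (f : C(X, ℝ)), M (f.comp ⟨fun x => k • x, continuous_const_smul k⟩) = M f) ∧
      ∀ (f : C(X, ℝ)) (c : ℝ),
        (∀ s : Γ, Λ (f.comp ⟨fun x => s • x, continuous_const_smul s⟩) = c) → M f = c := by
  obtain ⟨U, S, hne, hU⟩ := h.exists_ultrafilter
  let F : C(X, ℝ) → Γ → ℝ := fun f s => Λ (f.comp ⟨fun x => s • x, continuous_const_smul s⟩)
  let a : C(X, ℝ) → Finset Γ × ℕ → ℝ := fun f i => (∑ s ∈ S i, F f s) / (S i).card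
  have hpos : ∀ i, (0 : ℝ) < (S i).card := fun i => by exact_mod_cast (hne i).card_pos
  have hmono : ∀ f g : C(X, ℝ), f ≤ g → Λ f ≤ Λ g := fun f g hfg => by
    have := hΛ (g - f) (sub_nonneg.2 hfg)
    rwa [map_sub, sub_nonneg] at this
  have hFb : ∀ f s, |F f s| ≤ ‖f‖ * Λ 1 := fun f s => by
    have hconst : ∀ c : ℝ, c * Λ 1 = Λ (c • (1 : C(X, ℝ))) := fun c => by simp
    have hx : ∀ x, |f (s • x)| ≤ ‖f‖ := fun x => f.norm_coe_le_norm _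
    rw [abs_le, ← neg_mul, hconst, hconst]
    constructor <;> refine hmono _ _ fun x => ?_
    · simpa using (abs_le.1 (hx x)).1
    · simpa using (abs_le.1 (hx x)).2
  have hab : ∀ f i, a f i ∈ Set.Icc (-(‖f‖ * Λ 1)) (‖f‖ * Λ 1) := fun f i => by
    rw [Set.mem_Icc, ← abs_le, abs_div, abs_of_pos (hpos i), div_le_iff₀ (hpos i), mul_comm]
    refine (Finset.abs_sum_le_sum_abs _ _).trans ?_
    simpa using Finset.sum_le_card_nsmul (S i) _ _ fun s _ => hFb f s
  have hlim : ∀ f, ∃ l, Tendsto (a f) U (𝓝 l) := fun f => by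
    obtain ⟨l, -, hl⟩ := isCompact_Icc.ultrafilter_le_nhds' (U.map (a f))
      (Filter.mem_map.2 (Filter.univ_mem' (hab f)))
    exact ⟨l, hl⟩
  choose m hm using hlim
  refine ⟨{ toFun := m, map_add' := fun f g => ?_, map_smul' := fun c f => ?_ }, fun f hf => ?_,
    fun k f => ?_, fun f c hc => ?_⟩
  · refine tendsto_nhds_unique (hm (f + g)) (((hm f).add (hm g)).congr fun i => ?_)
    simp only [a]
    rw [← add_div, ← Finset.sum_add_distrib]
    congr 1
    exact Finset.sum_congr rfl fun s _ => (Λ.map_add _ _).symm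
  · refine tendsto_nhds_unique (hm (c • f)) (((hm f).const_mul c).congr fun i => ?_)
    simp only [a]
    rw [← mul_div_assoc, Finset.mul_sum]
    congr 1
    exact Finset.sum_congr rfl fun s _ => (Λ.map_smul _ _).symm
  · refine ge_of_tendsto' (hm f) fun i => ?_
    exact div_nonneg (Finset.sum_nonneg fun s _ => hΛ _ fun x => hf (s • x)) (hpos i).le
  · refine sub_eq_zero.1 (tendsto_nhds_unique (((hm _).sub (hm f)).congr fun i => ?_)
      (hU (F f) _ (hFb f) k))
    simp only [a, F]
    congr 3
    funext s
    refine congrArg Λ ?_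
    ext x
    simp [mul_smul]
  · refine tendsto_nhds_unique (hm f) (tendsto_const_nhds.congr fun i => ?_)
    simp only [a, F]
    rw [Finset.sum_congr rfl fun s _ => hc s, Finset.sum_const, nsmul_eq_mul,
      mul_div_cancel_left₀ _ (hpos i).ne']

/-- Two finite Borel measures on a space with outer approximable closed sets and equal integrals of
continuous functions agree. -/
theorem ext_of_forall_integral_continuousMap_eq {Z : Type*} [TopologicalSpace Z]
    [HasOuterApproxClosed Z] [MeasurableSpace Z] [BorelSpace Z] {μ ν : Measure Z}
    [IsFiniteMeasure μ] [IsFiniteMeasure ν]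
    (h : ∀ f : C(Z, ℝ), ∫ z, f z ∂μ = ∫ z, f z ∂ν) : μ = ν :=
  ext_of_forall_integral_eq_of_IsFiniteMeasure fun f => h f.toContinuousMap

/-- A quotient map whose fibres are the orbits of a group of homeomorphisms is open. -/
theorem isOpenMap_of_fibers_eq_orbits {Γ X Y : Type*} [Group Γ] [TopologicalSpace X]
    [MulAction Γ X] [ContinuousConstSMul Γ X] [TopologicalSpace Y] {π : X → Y}
    (hq : Topology.IsQuotientMap π)
    (hfib : ∀ x x' : X, π x = π x' ↔ x' ∈ MulAction.orbit Γ x) : IsOpenMap π := by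
  intro V hV
  rw [← hq.isOpen_preimage]
  have hpre : π ⁻¹' (π '' V) = ⋃ g : Γ, g • V := by
    ext x
    simp only [Set.mem_preimage, Set.mem_image, Set.mem_iUnion, Set.mem_smul_set, hfib,
      MulAction.mem_orbit_iff]
    exact ⟨fun ⟨v, hv, g, hg⟩ => ⟨g, v, hv, hg⟩, fun ⟨g, v, hv, hg⟩ => ⟨v, hv, g, hg⟩⟩
  rw [hpre]
  exact isOpen_iUnion fun g => hV.smul g

theorem pushforward_wellDefined_and_surjective
    (Γ : Type*) [Group Γ] [Countable Γ] (ham : FolnerAmenable Γ)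
    (H : Subgroup Γ) [H.Normal]
    (X : Type*) [MetricSpace X] [CompactSpace X]
    [MeasurableSpace X] [BorelSpace X]
    [MulAction Γ X] [ContinuousConstSMul Γ X]
    (Y : Type*) [TopologicalSpace Y] [T2Space Y]
    [MeasurableSpace Y] [BorelSpace Y]
    [MulAction (Γ ⧸ H) Y] [ContinuousConstSMul (Γ ⧸ H) Y]
    (π : X → Y) (hq : Topology.IsQuotientMap π)
    (hfib : ∀ x x' : X, π x = π x' ↔ x' ∈ MulAction.orbit H x)
    (hequiv : ∀ (s : Γ) (x : X), π (s • x) = (QuotientGroup.mk s : Γ ⧸ H) • π x) :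
    (∀ μ : MeasureTheory.Measure X, InvProb Γ X μ →
        InvProb (Γ ⧸ H) Y (MeasureTheory.Measure.map π μ)) ∧
    (∀ ν : MeasureTheory.Measure Y, InvProb (Γ ⧸ H) Y ν →
        ∃ μ : MeasureTheory.Measure X, InvProb Γ X μ ∧ MeasureTheory.Measure.map π μ = ν) := by
  have hπ : Measurable π := hq.continuous.measurable
  have hΓ : ∀ s : Γ, Measurable fun x : X => s • x := fun s =>
    (continuous_const_smul s).measurable
  have hG : ∀ g : Γ ⧸ H, Measurable fun y : Y => g • y := fun g =>
    (continuous_const_smul g).measurable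
  refine ⟨fun μ ⟨hμ, hinv⟩ => ⟨Measure.isProbabilityMeasure_map hπ.aemeasurable, fun g => ?_⟩,
    fun ν ⟨hν, hinv⟩ => ?_⟩
  · obtain ⟨s, rfl⟩ := QuotientGroup.mk_surjective g
    rw [Measure.map_map (hG _) hπ]
    conv_rhs => rw [← hinv s, Measure.map_map hπ (hΓ s)]
    congr 1
    ext x
    exact (hequiv s x).symm
  · have : CompactSpace Y := hq.surjective.compactSpace hq.continuous
    have : ContinuousConstSMul H X := ⟨fun h => continuous_const_smul (h : Γ)⟩
    have : SecondCountableTopology Y :=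
      hq.secondCountableTopology (isOpenMap_of_fibers_eq_orbits hq hfib)
    let : MetricSpace Y := TopologicalSpace.metrizableSpaceMetric Y
    obtain ⟨Λ, hΛ, hΛν⟩ := exists_positive_functional_lift ⟨π, hq.continuous⟩ hq.surjective ν
    obtain ⟨M, hM, hMinv, hMc⟩ := ham.exists_invariant_functional Λ hΛ
    have hMν : ∀ g : C(Y, ℝ), M (g.comp ⟨π, hq.continuous⟩) = ∫ y, g y ∂ν := fun g => by
      refine hMc _ _ fun s => ?_
      have hcomp : (g.comp ⟨π, hq.continuous⟩).comp
          (⟨fun x => s • x, continuous_const_smul s⟩ : C(X, X)) =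
          (g.comp ⟨fun y => (QuotientGroup.mk s : Γ ⧸ H) • y, continuous_const_smul _⟩).comp
            ⟨π, hq.continuous⟩ := by
        ext x
        exact congrArg g (hequiv s x)
      rw [hcomp, hΛν]
      conv_rhs => rw [← hinv (QuotientGroup.mk s), integral_map (hG _).aemeasurable
        g.continuous.aestronglyMeasurable]
      rfl
    obtain ⟨μ, hμ, hμM⟩ := exists_finiteMeasure_integral_eq M hM
    have hmap : Measure.map π μ = ν := by
      refine ext_of_forall_integral_continuousMap_eq fun g => ?_
      rw [integral_map hπ.aemeasurable g.continuous.aestronglyMeasurable, ← hMν, ← hμM]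
      rfl
    refine ⟨μ, ⟨⟨?_⟩, fun s => ?_⟩, hmap⟩
    · rw [← Set.preimage_univ (f := π), ← Measure.map_apply hπ MeasurableSet.univ, hmap,
        measure_univ]
    · refine ext_of_forall_integral_continuousMap_eq fun f => ?_
      rw [integral_map (hΓ s).aemeasurable f.continuous.aestronglyMeasurable, hμM f, ← hMinv s,
        ← hμM]
      rfl
end

section
/- Let A be a finite discrete alphabet and let w ∈ A^ℤ be a balanced almost periodic word for the left shift action of ℤ on A^ℤ. Then the amplified word ŵ ∈ A^{D∞} is almost periodic for the left shift action of D∞ on A^{D∞}. -/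
namespace Paper

/-- The `n`-shift of a bi-infinite word: `(n • w)(m) = w(m - n)`. -/
def zShift {A : Type*} (n : ℤ) (w : ℤ → A) : ℤ → A := fun m => w (m - n)

/-- A syndetic subset of `ℤ`. -/
def zSyndetic (R : Set ℤ) : Prop := ∃ K : Finset ℤ, ∀ n : ℤ, ∃ k ∈ K, n - k ∈ R

/-- `w` is almost periodic for the `ℤ`-shift. -/
def zAP {A : Type*} [TopologicalSpace A] (w : ℤ → A) : Prop :=
  ∀ U ∈ nhds w, zSyndetic {n : ℤ | zShift n w ∈ U}

/-- `w` is balanced: each recurrence set contains a symmetric syndetic set. -/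
def zBalanced {A : Type*} [TopologicalSpace A] (w : ℤ → A) : Prop :=
  ∀ U ∈ nhds w, ∃ P : Set ℤ, zSyndetic P ∧ P ⊆ {n : ℤ | zShift n w ∈ U} ∧ ∀ n, n ∈ P ↔ -n ∈ P

/-- The amplified word `ŵ` on the infinite dihedral group `D∞ = DihedralGroup 0`:
`ŵ(n) = w(n)` on the canonical copy `{r n}` of `ℤ`, and `ŵ(n·t) = w(-n)`,
i.e. `ŵ(sr m) = w(m)` (here `t = sr 0`). -/
def amplify {A : Type*} (w : ℤ → A) : DihedralGroup 0 → A
  | DihedralGroup.r i => w i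
  | DihedralGroup.sr i => w i

/-- The left shift action of a group `Γ` on `A^Γ`: `(g • x)(h) = x(g⁻¹ h)`. -/
instance shiftMulAction (Γ A : Type*) [Group Γ] : MulAction Γ (Γ → A) where
  smul g x h := x (g⁻¹ * h)
  one_smul x := funext fun h => by
    show x ((1:Γ)⁻¹ * h) = x h
    rw [inv_one, one_mul]
  mul_smul g₁ g₂ x := funext fun h => by
    show x ((g₁ * g₂)⁻¹ * h) = x (g₂⁻¹ * (g₁⁻¹ * h))
    rw [mul_inv_rev, mul_assoc]

/-- A syndetic subset of a group `Γ`: `K R = Γ` for some finite `K`. -/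
def gSyndetic {Γ : Type*} [Group Γ] (R : Set Γ) : Prop :=
  ∃ K : Finset Γ, ∀ g : Γ, ∃ k ∈ K, k⁻¹ * g ∈ R

/-- `x ∈ A^Γ` is almost periodic for the left shift. -/
def APoint {Γ A : Type*} [Group Γ] [TopologicalSpace A] (x : Γ → A) : Prop :=
  ∀ U ∈ nhds x, gSyndetic {g : Γ | g • x ∈ U}

/-- The orbit closure `O(x)` of `x ∈ A^Γ` under the left shift. -/
def OrbitClosure (Γ : Type*) [Group Γ] {A : Type*} [TopologicalSpace A] (x : Γ → A) :
    Set (Γ → A) :=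
  closure (MulAction.orbit Γ x)

/-- The restriction of the shift action to an orbit closure. -/
instance orbitClosureMulAction (Γ : Type*) [Group Γ] {A : Type*} [TopologicalSpace A]
    (x : Γ → A) : MulAction Γ (OrbitClosure Γ x) where
  smul g y := ⟨g • (y : Γ → A), by
    have hc : Continuous (fun z : Γ → A => g • z) :=
      continuous_pi fun h => continuous_apply (g⁻¹ * h)
    have h2 := image_closure_subset_closure_image (s := MulAction.orbit Γ x) hc
      ⟨(y : Γ → A), y.2, rfl⟩
    have h3 : (fun z : Γ → A => g • z) '' MulAction.orbit Γ x = MulAction.orbit Γ x := by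
      rw [Set.image_smul, MulAction.smul_orbit]
    rw [h3] at h2
    exact h2⟩
  one_smul y := Subtype.ext (one_smul Γ (y : Γ → A))
  mul_smul g₁ g₂ y := Subtype.ext (mul_smul g₁ g₂ (y : Γ → A))

end Paper

open Paper

namespace Paper

/-- The word on `D∞` reading `p.1` on the rotations and `p.2` on the reflections. -/
def dihedralGlue {A : Type*} (p : (ℤ → A) × (ℤ → A)) : DihedralGroup 0 → A
  | DihedralGroup.r i => p.1 i
  | DihedralGroup.sr i => p.2 i

theorem dihedralGlue_self {A : Type*} (w : ℤ → A) : dihedralGlue (w, w) = amplify w := by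
  funext g
  cases g <;> rfl

theorem continuous_dihedralGlue {A : Type*} [TopologicalSpace A] :
    Continuous (dihedralGlue : (ℤ → A) × (ℤ → A) → DihedralGroup 0 → A) := by
  refine continuous_pi fun g => ?_
  cases g with
  | r i => exact (continuous_apply (A := fun _ : ℤ => A) i).comp continuous_fst
  | sr i => exact (continuous_apply (A := fun _ : ℤ => A) i).comp continuous_snd

theorem r_smul_amplify {A : Type*} (w : ℤ → A) (n : ℤ) :
    (DihedralGroup.r n : DihedralGroup 0) • amplify w
      = dihedralGlue (zShift n w, zShift (-n) w) := by
  funext g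
  change amplify w ((DihedralGroup.r n : DihedralGroup 0)⁻¹ * g) = _
  cases g with
  | r i => exact congrArg w (neg_add_eq_sub n i)
  | sr i => rfl

theorem gSyndetic_image_r {P : Set ℤ} (hP : zSyndetic P) :
    gSyndetic ((fun n : ℤ => (DihedralGroup.r n : DihedralGroup 0)) '' P) := by
  classical
  obtain ⟨K, hK⟩ := hP
  refine ⟨K.image (fun k : ℤ => (DihedralGroup.r k : DihedralGroup 0)) ∪
    K.image (fun k : ℤ => (DihedralGroup.sr k : DihedralGroup 0)), fun g => ?_⟩
  cases g with
  | r m =>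
    obtain ⟨k, hk, hkP⟩ := hK m
    refine ⟨DihedralGroup.r k, Finset.mem_union_left _ (Finset.mem_image_of_mem _ hk),
      _, hkP, congrArg (DihedralGroup.r (n := 0)) (neg_add_eq_sub (α := ℤ) k m).symm⟩
  | sr m =>
    obtain ⟨k, hk, hkP⟩ := hK m
    refine ⟨DihedralGroup.sr k, Finset.mem_union_right _ (Finset.mem_image_of_mem _ hk),
      _, hkP, rfl⟩

end Paper

theorem amplify_almostPeriodic
    (A : Type*) [TopologicalSpace A] [DiscreteTopology A] [Finite A]
    (w : ℤ → A) (hap : zAP w) (hbal : zBalanced w) :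
    APoint (amplify w) := by
  intro U hU
  rw [← dihedralGlue_self] at hU
  have hpre := continuous_dihedralGlue.continuousAt.preimage_mem_nhds hU
  obtain ⟨V₁, hV₁, V₂, hV₂, hV⟩ := mem_nhds_prod_iff.mp hpre
  obtain ⟨P, hP, hPV, hsymm⟩ := hbal (V₁ ∩ V₂) (Filter.inter_mem hV₁ hV₂)
  obtain ⟨K, hK⟩ := gSyndetic_image_r hP
  refine ⟨K, fun g => ?_⟩
  obtain ⟨k, hk, n, hn, hng⟩ := hK g
  refine ⟨k, hk, ?_⟩
  rw [← hng, Set.mem_ofPred_eq, r_smul_amplify]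
  exact hV ⟨(hPV hn).1, (hPV ((hsymm n).mp hn)).2⟩
end
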